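/- arXiv:math/9311206 — 12 statements merged into one kernel-verified Lean document; each statement's English description precedes it below -/
import Mathlib

section
/- Let X be a set and let I be a family of subsets of X that contains all singletons and is closed under subsets. If u is an I-ultrafilter on ℕ and v is an ultrafilter on ℕ with v ≤_RK u, then v is an I-ultrafilter. -/
open Set Topology Filter MeasureTheory

/-- The Cantor space `2^ω = ℕ → Bool` with the product topology. -/
abbrev Cantor := ℕ → Bool

/-- `u` is an `I`-ultrafilter: for every `F : ℕ → X` there is `A ∈ u` with `F '' A ∈ I`. -/
def IUltra {X : Type*} (I : Set (Set X)) (u : Ultrafilter ℕ) : Prop :=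
  ∀ F : ℕ → X, ∃ A ∈ u, F '' A ∈ I

/-- The same notion for ultrafilters on `ℕ × ℕ`. -/
def IUltra2 {X : Type*} (I : Set (Set X)) (u : Ultrafilter (ℕ × ℕ)) : Prop :=
  ∀ F : ℕ × ℕ → X, ∃ A ∈ u, F '' A ∈ I

/-- `u` is a P-point: nonprincipal, and every countable family of members of `u`
has a pseudo-intersection in `u`. -/
def IsPPoint (u : Ultrafilter ℕ) : Prop :=
  (∀ a : ℕ, u ≠ pure a) ∧
    ∀ A : ℕ → Set ℕ, (∀ n, A n ∈ u) → ∃ B ∈ u, ∀ n, (B \ A n).Finite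

/-- A subset of Cantor space is discrete: every point of `A` is isolated in `A`. -/
def DiscreteSet (A : Set Cantor) : Prop :=
  ∀ x ∈ A, ∃ U : Set Cantor, IsOpen U ∧ A ∩ U = {x}

/-- A subset of Cantor space is scattered: every nonempty subset has an isolated point. -/
def ScatteredSet (A : Set Cantor) : Prop :=
  ∀ B ⊆ A, B.Nonempty → ∃ x ∈ B, ∃ U : Set Cantor, IsOpen U ∧ B ∩ U = {x}

/-- The basic clopen cylinder `[s]` determined by a finite binary sequence `s`. -/
def cyl (s : List Bool) : Set Cantor := {f | ∀ i : Fin s.length, f i = s.get i}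

/-- `I` is an ideal: closed under subsets and finite unions. -/
def IsIdeal (I : Set (Set Cantor)) : Prop :=
  (∀ A B : Set Cantor, A ⊆ B → B ∈ I → A ∈ I) ∧
    (∀ A B : Set Cantor, A ∈ I → B ∈ I → A ∪ B ∈ I)

/-- `I` is closed under discrete unions. -/
def ClosedUnderDiscreteUnions (I : Set (Set Cantor)) : Prop :=
  ∀ (X G : ℕ → Set Cantor), (∀ n, X n ∈ I) → (∀ n, IsOpen (G n)) →
    Pairwise (Function.onFun Disjoint G) → (⋃ n, X n ∩ G n) ∈ I

/-- A discrete ideal: an ideal closed under discrete unions. -/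
def DiscreteIdeal (I : Set (Set Cantor)) : Prop := IsIdeal I ∧ ClosedUnderDiscreteUnions I

/-- `I` is closed under scattered unions. -/
def ClosedUnderScatteredUnions (I : Set (Set Cantor)) : Prop :=
  ∀ (S : Set (List Bool)) (X : List Bool → Set Cantor),
    S.WellFoundedOn (fun s t => cyl s ⊂ cyl t) → (∀ s ∈ S, X s ∈ I) →
    (⋃ s ∈ S, X s ∩ cyl s) ∈ I

/-- The sum `∑_u v_n`: the ultrafilter on `ℕ × ℕ` with
`X ∈ ∑_u v_n ↔ {n | {m | (n, m) ∈ X} ∈ v n} ∈ u`. -/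
def ultraSum (u : Ultrafilter ℕ) (v : ℕ → Ultrafilter ℕ) : Ultrafilter (ℕ × ℕ) :=
  u.bind fun n => (v n).map fun m => (n, m)

/-- Iterated derivative: `dA = {x ∈ A : x is an accumulation point of A}`;
`A` has level `≤ k` iff `d^k A = ∅`. -/
def HasLevelLE (k : ℕ) (A : Set Cantor) : Prop :=
  (fun B : Set Cantor => {x ∈ B | AccPt x (𝓟 B)})^[k] A = ∅

/-- Finite Fubini powers of `u` (relative to a pairing bijection `e`). -/
noncomputable def ultraPow (e : ℕ × ℕ ≃ ℕ) (u : Ultrafilter ℕ) : ℕ → Ultrafilter ℕ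
  | 0 => pure 0
  | n + 1 => Ultrafilter.map e (ultraSum u fun _ => ultraPow e u n)

/-- `u^ω = ∑_u ⟨u^n : n < ω⟩`, an ultrafilter on `ℕ × ℕ`. -/
noncomputable def ultraPowOmega (e : ℕ × ℕ ≃ ℕ) (u : Ultrafilter ℕ) : Ultrafilter (ℕ × ℕ) :=
  ultraSum u (ultraPow e u)

/-- The order type of a set of ordinals. -/
noncomputable def tp (X : Set Ordinal) : Ordinal := Ordinal.type ((· < ·) : X → X → Prop)

/-- The first uncountable ordinal. -/
noncomputable def omega1 : Ordinal := (Cardinal.aleph 1).ord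

/-- `u` is an `α`-ultrafilter (`I_α`-ultrafilter, where `I_α` is the family of subsets of
`ω₁` of order type `≤ α`). -/
def AlphaUltra (α : Ordinal) (u : Ultrafilter ℕ) : Prop :=
  ∀ F : ℕ → Ordinal, (∀ n, F n < omega1) → ∃ A ∈ u, tp (F '' A) ≤ α

/-- `u` is a `J_α`-ultrafilter (`J_α` is the family of subsets of `ω₁` of order type `< α`). -/
def JUltra (α : Ordinal) (u : Ultrafilter ℕ) : Prop :=
  ∀ F : ℕ → Ordinal, (∀ n, F n < omega1) → ∃ A ∈ u, tp (F '' A) < α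

/-- The `J_α`-ultrafilter notion for ultrafilters on `ℕ × ℕ`. -/
def JUltra2 (α : Ordinal) (u : Ultrafilter (ℕ × ℕ)) : Prop :=
  ∀ F : ℕ × ℕ → Ordinal, (∀ p, F p < omega1) → ∃ A ∈ u, tp (F '' A) < α

/-- `I`-ultrafilters are closed downward under the Rudin–Keisler ordering. -/
theorem stmt0 {X : Type*} (I : Set (Set X))
    (hsing : ∀ x : X, {x} ∈ I) (hsub : ∀ A B : Set X, A ⊆ B → B ∈ I → A ∈ I)
    (u v : Ultrafilter ℕ) (hu : IUltra I u)
    (hRK : ∃ f : ℕ → ℕ, v = Ultrafilter.map f u) : IUltra I v := by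
  obtain ⟨f, rfl⟩ := hRK
  intro F
  obtain ⟨A, hA, hFA⟩ := hu (F ∘ f)
  refine ⟨f '' A, Filter.image_mem_map hA, ?_⟩
  rwa [← Set.image_comp]
end

section
/- Let 2^ω carry the lexicographic linear order (the Lex order on ℕ → Bool, where Bool is ordered by false < true), and let I be the family of sets Y ⊆ 2^ω that are finite, or order-isomorphic to ℕ, or order-isomorphic to the order dual of ℕ (order types ω and ω*). Then a nonprincipal ultrafilter u on ℕ is an I-ultrafilter if and only if u is a P-point. -/
open Set Topology Filter MeasureTheory

/-- An infinite linear order all of whose initial segments are finite has order type `ω`. -/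
theorem nonempty_orderIso_nat_of_finite_Iic {α : Type*} [LinearOrder α] [Infinite α]
    (h : ∀ a : α, (Iic a).Finite) : Nonempty (α ≃o ℕ) := by
  obtain ⟨a₀⟩ : Nonempty α := inferInstance
  obtain ⟨b, hb, hmin⟩ := (h a₀).exists_minimal ⟨a₀, self_mem_Iic⟩
  let _ : OrderBot α :=
    { bot := b
      bot_le := fun a => by
        by_contra hlt
        push Not at hlt
        exact (hmin (hlt.le.trans hb) hlt.le).not_gt hlt }
  have : NoMaxOrder α :=
    ⟨fun a => by
      by_contra! hmax
      exact Set.infinite_univ ((h a).subset fun c _ => hmax c)⟩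
  let _ : LocallyFiniteOrder α :=
    LocallyFiniteOrder.ofFiniteIcc fun _ c => (h c).subset Icc_subset_Iic_self
  let _ : SuccOrder α := LinearLocallyFiniteOrder.succOrder α
  let _ : PredOrder α := LinearLocallyFiniteOrder.predOrder α
  exact ⟨orderIsoNatOfLinearSuccPredArch⟩

theorem finite_or_nonempty_orderIso_nat {α : Type*} [LinearOrder α] {Y : Set α}
    (h : ∀ y ∈ Y, (Y ∩ Iic y).Finite) : Y.Finite ∨ Nonempty (Y ≃o ℕ) := by
  refine Y.finite_or_infinite.imp_right fun hY => ?_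
  have := hY.to_subtype
  refine nonempty_orderIso_nat_of_finite_Iic fun y => ?_
  exact ((h y y.2).preimage Subtype.val_injective.injOn).subset fun z hz => ⟨z.2, hz⟩

theorem finite_or_nonempty_orderIso_nat_dual {α : Type*} [LinearOrder α] {Y : Set α}
    (h : ∀ y ∈ Y, (Y ∩ Ici y).Finite) : Y.Finite ∨ Nonempty (Y ≃o ℕᵒᵈ) := by
  refine Y.finite_or_infinite.imp_right fun hY => ?_
  have := hY.to_subtype
  have : Infinite (↥Y)ᵒᵈ := Infinite.of_injective _ (OrderDual.toDual (α := Y)).injective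
  have hIic (y : (↥Y)ᵒᵈ) : (Iic y).Finite :=
    ((h (OrderDual.ofDual y : Y) (OrderDual.ofDual y : Y).2).preimage
      (Subtype.val_injective.comp OrderDual.ofDual.injective).injOn).subset
      fun z hz => ⟨(OrderDual.ofDual z : Y).2, hz⟩
  obtain ⟨e⟩ := nonempty_orderIso_nat_of_finite_Iic hIic
  exact ⟨(OrderIso.dualDual Y).trans e.dual⟩

theorem Ultrafilter.infinite_of_mem {α : Type*} {u : Ultrafilter α} (hu : ∀ a, u ≠ pure a)
    {s : Set α} (hs : s ∈ u) : s.Infinite := fun hfin =>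
  let ⟨a, _, ha⟩ := Ultrafilter.eq_pure_of_finite_mem hfin hs
  hu a ha

theorem Ultrafilter.Ioi_mem {u : Ultrafilter ℕ} (hu : ∀ a, u ≠ pure a) (n : ℕ) : Ioi n ∈ u := by
  rw [← compl_Iic, Ultrafilter.compl_mem_iff_notMem]
  exact fun h => Ultrafilter.infinite_of_mem hu h (finite_Iic n)

/-- A nonprincipal `u` is a P-point if every function unbounded modulo `u` is finite-to-one on a
member of `u`. -/
theorem isPPoint_of_forall_nat {u : Ultrafilter ℕ} (hu : ∀ a, u ≠ pure a)
    (h : ∀ f : ℕ → ℕ, (∀ n, {k | n < f k} ∈ u) → ∃ B ∈ u, ∀ n, {k ∈ B | f k ≤ n}.Finite) :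
    IsPPoint u := by
  classical
  refine ⟨hu, fun A hA => ?_⟩
  have hex (k : ℕ) : ∃ n, k ∉ A n ∩ Ioi n := ⟨k, fun hk => lt_irrefl k hk.2⟩
  obtain ⟨B, hB, hfin⟩ := h (fun k => Nat.find (hex k)) fun n => by
    refine mem_of_superset ((biInter_mem (finite_Iic n)).2 fun i _ =>
      inter_mem (hA i) (Ultrafilter.Ioi_mem hu i)) fun k hk => ?_
    simp only [mem_ofPred_eq, Nat.lt_find_iff, not_not]
    exact fun m hm => mem_iInter₂.1 hk m hm
  exact ⟨B, hB, fun n => (hfin n).subset fun k hk =>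
    ⟨hk.1, Nat.find_min' (hex k) fun hk' => hk.2 hk'.1⟩⟩

/-- The point `1ⁿ 0 0ᵏ 1 0 0 ⋯` of `2^ω` for `n = f k`. -/
def lexCode (f : ℕ → ℕ) (k : ℕ) : Lex (ℕ → Bool) :=
  toLex fun i => decide (i < f k ∨ i = f k + 1 + k)

theorem lexCode_lt_lexCode {f : ℕ → ℕ} {k l : ℕ} (h : f k < f l) : lexCode f k < lexCode f l := by
  refine ⟨f k, fun j hj => ?_, ?_⟩
  · simp [lexCode, hj, hj.trans h]
  · have : f k ≠ f k + 1 + k := by lia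
    simp [lexCode, h, this]

theorem lexCode_injective (f : ℕ → ℕ) : Function.Injective (lexCode f) := by
  intro k l h
  have hf : f k = f l := by
    by_contra hne
    rcases lt_or_gt_of_ne hne with hlt | hlt
    · exact (lexCode_lt_lexCode hlt).ne h
    · exact (lexCode_lt_lexCode hlt).ne' h
  have hk : f k + 1 + k < f l ∨ f k + 1 + k = f l + 1 + l := by
    simpa [lexCode] using congrFun (congrArg ofLex h) (f k + 1 + k)
  lia

/-- A point agreeing with `x` on a long enough initial segment lies above any given `y < x`. -/
theorem exists_forall_lt_of_lex_lt {x y : Lex (ℕ → Bool)} (h : y < x) :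
    ∃ n, ∀ z : Lex (ℕ → Bool), (∀ i ≤ n, ofLex z i = ofLex x i) → y < z := by
  obtain ⟨n, heq, hlt⟩ := h
  exact ⟨n, fun z hz => ⟨n, fun j hj => (heq j hj).trans (hz j hj.le).symm,
    hlt.trans_eq (hz n le_rfl).symm⟩⟩

theorem exists_forall_gt_of_lex_lt {x y : Lex (ℕ → Bool)} (h : x < y) :
    ∃ n, ∀ z : Lex (ℕ → Bool), (∀ i ≤ n, ofLex z i = ofLex x i) → z < y := by
  obtain ⟨n, heq, hlt⟩ := h
  exact ⟨n, fun z hz => ⟨n, fun j hj => (hz j hj.le).trans (heq j hj),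
    (hz n le_rfl).trans_lt hlt⟩⟩

theorem Ultrafilter.exists_eventually_eq_lex (u : Ultrafilter ℕ) (F : ℕ → Lex (ℕ → Bool)) :
    ∃ x : Lex (ℕ → Bool), ∀ n, {k | ∀ i ≤ n, ofLex (F k) i = ofLex x i} ∈ u := by
  have hx (i : ℕ) : ∃ b : Bool, {k | ofLex (F k) i = b} ∈ u := by
    rcases u.mem_or_compl_mem {k | ofLex (F k) i = true} with h | h
    · exact ⟨true, h⟩
    · exact ⟨false, by simpa [compl_ofPred] using h⟩
  choose x hx using hx
  refine ⟨toLex x, fun n => mem_of_superset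
    ((biInter_mem (finite_Iic n)).2 fun i _ => hx i) fun k hk i hi => mem_iInter₂.1 hk i hi⟩

theorem IsPPoint.of_iUltra_lex {u : Ultrafilter ℕ} (hu : ∀ a, u ≠ pure a)
    (h : IUltra {Y : Set (Lex (ℕ → Bool)) |
      Y.Finite ∨ Nonempty (Y ≃o ℕ) ∨ Nonempty (Y ≃o ℕᵒᵈ)} u) : IsPPoint u := by
  refine isPPoint_of_forall_nat hu fun f hf => ?_
  obtain ⟨A, hA, hfin | ⟨⟨e⟩⟩ | ⟨⟨e⟩⟩⟩ := h (lexCode f)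
  · exact absurd (hfin.of_finite_image (lexCode_injective f).injOn)
      (Ultrafilter.infinite_of_mem hu hA)
  · refine ⟨A, hA, fun n => ?_⟩
    obtain ⟨a, haA, ha⟩ := u.nonempty_of_mem (inter_mem hA (hf n))
    have hIic : (Iic (⟨lexCode f a, a, haA, rfl⟩ : lexCode f '' A)).Finite := by
      refine ((finite_Iic (e ⟨lexCode f a, a, haA, rfl⟩)).preimage e.injective.injOn).subset ?_
      exact fun z hz => e.monotone hz
    refine ((hIic.image Subtype.val).preimage (lexCode_injective f).injOn).subset fun k hk => ?_
    exact ⟨⟨_, k, hk.1, rfl⟩, (lexCode_lt_lexCode (hk.2.trans_lt ha)).le, rfl⟩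
  · obtain ⟨a, haA⟩ := u.nonempty_of_mem hA
    have hIci : (Ici (⟨lexCode f a, a, haA, rfl⟩ : lexCode f '' A)).Finite := by
      refine (((finite_Iic (OrderDual.ofDual (e ⟨lexCode f a, a, haA, rfl⟩))).preimage
        OrderDual.ofDual.injective.injOn).preimage e.injective.injOn).subset ?_
      exact fun z hz => e.monotone hz
    refine absurd (((hIci.image Subtype.val).preimage (lexCode_injective f).injOn).subset
      fun k hk => ?_) (Ultrafilter.infinite_of_mem hu (inter_mem hA (hf (f a))))
    exact ⟨⟨_, k, hk.1, rfl⟩, (lexCode_lt_lexCode hk.2).le, rfl⟩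

theorem IsPPoint.iUltra_lex {u : Ultrafilter ℕ} (h : IsPPoint u) :
    IUltra {Y : Set (Lex (ℕ → Bool)) |
      Y.Finite ∨ Nonempty (Y ≃o ℕ) ∨ Nonempty (Y ≃o ℕᵒᵈ)} u := by
  intro F
  obtain ⟨x, hx⟩ := u.exists_eventually_eq_lex F
  obtain ⟨B, hB, hfin⟩ := h.2 _ hx
  have hcover : {k | F k = x} ∪ ({k | F k < x} ∪ {k | x < F k}) ∈ u := by
    refine univ_mem' fun k => ?_
    rcases lt_trichotomy (F k) x with hk | hk | hk
    exacts [.inr (.inl hk), .inl hk, .inr (.inr hk)]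
  rcases Ultrafilter.union_mem_iff.1 hcover with heq | hne
  · exact ⟨_, heq, .inl ((finite_singleton x).subset (image_subset_iff.2 fun k hk => hk))⟩
  rcases Ultrafilter.union_mem_iff.1 hne with hlt | hgt
  · refine ⟨_, inter_mem hB hlt, (finite_or_nonempty_orderIso_nat ?_).imp_right .inl⟩
    rintro _ ⟨l, ⟨_, hl⟩, rfl⟩
    obtain ⟨n, hn⟩ := exists_forall_lt_of_lex_lt hl
    refine ((hfin n).image F).subset ?_
    rintro _ ⟨⟨k, hk, rfl⟩, hle⟩
    exact ⟨k, ⟨hk.1, fun hag => (hn _ hag).not_ge hle⟩, rfl⟩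
  · refine ⟨_, inter_mem hB hgt, (finite_or_nonempty_orderIso_nat_dual ?_).imp_right .inr⟩
    rintro _ ⟨l, ⟨_, hl⟩, rfl⟩
    obtain ⟨n, hn⟩ := exists_forall_gt_of_lex_lt hl
    refine ((hfin n).image F).subset ?_
    rintro _ ⟨⟨k, hk, rfl⟩, hle⟩
    exact ⟨k, ⟨hk.1, fun hag => (hn _ hag).not_ge hle⟩, rfl⟩

/-- Booth: with `I` the sets of lexicographic order type finite, `ω` or `ω*`
in `2^ω`, the nonprincipal `I`-ultrafilters are exactly the P-points. -/
theorem stmt1 (u : Ultrafilter ℕ) (hnp : ∀ a : ℕ, u ≠ pure a) :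
    IUltra {Y : Set (Lex (ℕ → Bool)) |
      Y.Finite ∨ Nonempty (Y ≃o ℕ) ∨ Nonempty (Y ≃o ℕᵒᵈ)} u ↔ IsPPoint u :=
  ⟨IsPPoint.of_iUltra_lex hnp, IsPPoint.iUltra_lex⟩
end

section
/- Every P-point ultrafilter on ℕ is a discrete ultrafilter. -/
open Set Topology Filter MeasureTheory

/-- Every sequence in Cantor space has, coordinatewise, a limit along an ultrafilter. -/
theorem exists_coordinatewise_limit (u : Ultrafilter ℕ) (F : ℕ → Cantor) :
    ∃ x : Cantor, ∀ n, {k | F k n = x n} ∈ u := by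
  have h : ∀ n, ∃ b : Bool, {k | F k n = b} ∈ u := by
    intro n
    rcases u.mem_or_compl_mem {k | F k n = true} with h | h
    · exact ⟨true, h⟩
    · exact ⟨false, mem_of_superset h fun k hk => by simpa using hk⟩
  choose x hx using h
  exact ⟨x, hx⟩

/-- A set avoiding `x` is discrete if only finitely many of its points differ from `x` at any
given coordinate. -/
theorem discreteSet_of_finite_ne {S : Set Cantor} {x : Cantor} (hxS : x ∉ S)
    (hS : ∀ n, {z ∈ S | z n ≠ x n}.Finite) : DiscreteSet S := by
  intro y hy
  have hyx : y ≠ x := fun h => hxS (h ▸ hy)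
  obtain ⟨n, hn⟩ := Function.ne_iff.mp hyx
  refine ⟨{z | z n ≠ x n} \ ({z ∈ S | z n ≠ x n} \ {y}), ?_, ?_⟩
  · refine IsOpen.sdiff ?_ ((hS n).subset sdiff_subset).isClosed
    have hc : Continuous fun z : Cantor => z n := continuous_apply n
    exact (isOpen_discrete {b : Bool | b ≠ x n}).preimage hc
  · ext z
    constructor
    · rintro ⟨hzS, hzn, hz⟩
      by_contra hzy
      exact hz ⟨⟨hzS, hzn⟩, hzy⟩
    · rintro rfl
      exact ⟨hy, hn, fun h => h.2 rfl⟩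

/-- every P-point is a discrete ultrafilter. -/
theorem stmt2 (u : Ultrafilter ℕ) (hu : IsPPoint u) :
    IUltra {A : Set Cantor | DiscreteSet A} u := by
  intro F
  obtain ⟨x, hx⟩ := exists_coordinatewise_limit u F
  rcases u.mem_or_compl_mem {k | F k = x} with h | h
  · refine ⟨_, h, ?_⟩
    rintro _ ⟨k, hk, rfl⟩
    refine ⟨univ, isOpen_univ, ?_⟩
    ext z
    constructor
    · rintro ⟨⟨j, hj, rfl⟩, -⟩
      exact Eq.trans hj (Eq.symm hk)
    · rintro rfl
      exact ⟨⟨k, hk, rfl⟩, mem_univ _⟩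
  · obtain ⟨B, hB, hfin⟩ := hu.2 _ hx
    refine ⟨B ∩ {k | F k = x}ᶜ, inter_mem hB h, discreteSet_of_finite_ne (x := x) ?_ ?_⟩
    · rintro ⟨k, ⟨-, hk⟩, hkx⟩
      exact hk hkx
    · intro n
      refine ((hfin n).image F).subset ?_
      rintro _ ⟨⟨k, ⟨hkB, -⟩, rfl⟩, hkn⟩
      exact ⟨k, ⟨hkB, hkn⟩, rfl⟩
end

section
/- The family of scattered subsets of 2^ω is a discrete ideal containing all singletons, and it is the smallest such: every scattered subset of 2^ω belongs to every discrete ideal that contains all singletons. -/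
open Set Topology Filter MeasureTheory

theorem ScatteredSet.mono {A B : Set Cantor} (h : A ⊆ B) (hB : ScatteredSet B) :
    ScatteredSet A :=
  fun C hC => hB C (hC.trans h)

theorem scatteredSet_singleton (x : Cantor) : ScatteredSet {x} := by
  intro B hB hne
  obtain rfl := (subset_singleton_iff_eq.1 hB).resolve_left hne.ne_empty
  exact ⟨x, rfl, univ, isOpen_univ, inter_univ _⟩

theorem ScatteredSet.union {A A' : Set Cantor} (hA : ScatteredSet A) (hA' : ScatteredSet A') :
    ScatteredSet (A ∪ A') := by
  intro B hB hne
  rcases (B ∩ A).eq_empty_or_nonempty with h | h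
  · exact hA' B (fun z hz => (hB hz).resolve_left fun hzA =>
      (h ▸ (⟨hz, hzA⟩ : z ∈ B ∩ A) : z ∈ (∅ : Set Cantor))) hne
  obtain ⟨x, hx, U, hU, hxU⟩ := hA _ inter_subset_right h
  have hxU' : x ∈ U := by
    have : x ∈ B ∩ A ∩ U := hxU ▸ mem_singleton x
    exact this.2
  rcases ((B ∩ U) \ {x}).eq_empty_or_nonempty with h | h
  · exact ⟨x, hx.1, U, hU, (sdiff_eq_empty.1 h).antisymm (singleton_subset_iff.2 ⟨hx.1, hxU'⟩)⟩
  have hsub : (B ∩ U) \ {x} ⊆ A' := fun z ⟨⟨hzB, hzU⟩, hzx⟩ =>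
    (hB hzB).resolve_left fun hzA => hzx (hxU ▸ ⟨⟨hzB, hzA⟩, hzU⟩)
  obtain ⟨y, hy, V, hV, hyV⟩ := hA' _ hsub h
  refine ⟨y, hy.1.1, (U ∩ {x}ᶜ) ∩ V, (hU.inter isOpen_compl_singleton).inter hV, ?_⟩
  rw [← hyV, sdiff_eq, ← inter_assoc, ← inter_assoc]

theorem closedUnderDiscreteUnions_scatteredSet :
    ClosedUnderDiscreteUnions {A : Set Cantor | ScatteredSet A} := by
  intro X G hX hG hdisj B hB ⟨b, hb⟩
  obtain ⟨n, -, hbG⟩ := mem_iUnion.1 (hB hb)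
  have hsub : B ∩ G n ⊆ X n := by
    rintro z ⟨hzB, hzG⟩
    obtain ⟨m, hzX, hzG'⟩ := mem_iUnion.1 (hB hzB)
    obtain rfl : m = n := by
      by_contra hmn
      exact disjoint_left.1 (hdisj hmn) hzG' hzG
    exact hzX
  obtain ⟨x, hx, U, hU, hxU⟩ := hX n _ hsub ⟨b, hb, hbG⟩
  exact ⟨x, hx.1, G n ∩ U, (hG n).inter hU, by rw [← inter_assoc, hxU]⟩

/-- A discrete ideal contains a set as soon as it contains its traces on countably many clopen
sets covering it. -/
theorem DiscreteIdeal.inter_iUnion_mem {I : Set (Set Cantor)} (hI : DiscreteIdeal I)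
    {A : Set Cantor} {U : ℕ → Set Cantor} (hU : ∀ n, IsClopen (U n)) (hA : ∀ n, A ∩ U n ∈ I) :
    A ∩ ⋃ n, U n ∈ I := by
  have hopen (n : ℕ) : IsOpen (disjointed U n) :=
    disjointedRec (p := IsOpen) (fun {_ i} ht => ht.sdiff (hU i).isClosed) (hU n).isOpen
  refine hI.1.1 _ _ ?_ (hI.2 _ _ hA hopen (disjoint_disjointed U))
  rw [← iUnion_disjointed, inter_iUnion]
  exact iUnion_mono fun n x hx => ⟨⟨hx.1, disjointed_subset U n hx.2⟩, hx.2⟩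

theorem ScatteredSet.mem_of_discreteIdeal {A : Set Cantor} (hA : ScatteredSet A)
    {I : Set (Set Cantor)} (hI : DiscreteIdeal I) (hsing : ∀ x : Cantor, {x} ∈ I) : A ∈ I := by
  set S : Set (Set Cantor) := {U | IsClopen U ∧ A ∩ U ∈ I}
  have hempty : ∅ ∈ S :=
    ⟨isClopen_empty, hI.1.1 _ _ (by simp) (hsing fun _ => false)⟩
  obtain ⟨T, hTc, hTS, hTU⟩ :=
    TopologicalSpace.isOpen_sUnion_countable S fun U hU => hU.1.isOpen
  obtain ⟨U, hU⟩ := (hTc.insert ∅).exists_eq_range (insert_nonempty _ _)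
  have hUS (n : ℕ) : U n ∈ S := by
    have : U n ∈ insert ∅ T := hU ▸ mem_range_self n
    rcases this with h | h
    · exact h ▸ hempty
    · exact hTS h
  have hW : A ∩ ⋃₀ S ∈ I := by
    have := hI.inter_iUnion_mem (fun n => (hUS n).1) fun n => (hUS n).2
    rwa [← sUnion_range, ← hU, sUnion_insert, empty_union, hTU] at this
  suffices h : A \ ⋃₀ S = ∅ from
    hI.1.1 _ _ (subset_inter Subset.rfl (sdiff_eq_empty.1 h)) hW
  by_contra hne
  obtain ⟨x, hx, V, hV, hxV⟩ := hA _ sdiff_subset (nonempty_iff_ne_empty.2 hne)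
  have hxV' : x ∈ A \ ⋃₀ S ∩ V := hxV ▸ mem_singleton x
  obtain ⟨C, hC, hxC, hCV⟩ := compact_exists_isClopen_in_isOpen hV hxV'.2
  refine hx.2 ⟨C, ⟨hC, hI.1.1 _ _ ?_ (hI.1.2 _ _ hW (hsing x))⟩, hxC⟩
  rintro z ⟨hzA, hzC⟩
  by_cases hz : z ∈ ⋃₀ S
  · exact Or.inl ⟨hzA, hz⟩
  · exact Or.inr (hxV ▸ ⟨⟨hzA, hz⟩, hCV hzC⟩)

/-- the scattered subsets of `2^ω` form the smallest discrete ideal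
containing all singletons. -/
theorem stmt7 :
    (DiscreteIdeal {A : Set Cantor | ScatteredSet A} ∧
      ∀ x : Cantor, {x} ∈ {A : Set Cantor | ScatteredSet A}) ∧
    ∀ I : Set (Set Cantor), DiscreteIdeal I → (∀ x : Cantor, {x} ∈ I) →
      {A : Set Cantor | ScatteredSet A} ⊆ I := by
  exact ⟨⟨⟨⟨fun _ _ h hB => hB.mono h, fun _ _ hA hB => hA.union hB⟩,
    closedUnderDiscreteUnions_scatteredSet⟩, scatteredSet_singleton⟩,
    fun _ hI hsing _ hA => hA.mem_of_discreteIdeal hI hsing⟩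
end

section
/- Let I be a discrete ideal of subsets of 2^ω containing all singletons. If v_n (n ∈ ℕ) are I-ultrafilters on ℕ and u is a scattered ultrafilter on ℕ, then the sum ∑_u v_n is an I-ultrafilter on ℕ × ℕ. -/
open Set Topology Filter MeasureTheory

/-- The part of `F` over the indices `n` with `x n ∈ T` has an image in `I`, after restricting
each section `F (n, ·)` to a suitable member of `v n`. -/
def SmallOver (I : Set (Set Cantor)) (v : ℕ → Ultrafilter ℕ) (F : ℕ × ℕ → Cantor)
    (x : ℕ → Cantor) (T : Set Cantor) : Prop :=
  ∃ B : ℕ → Set ℕ, (∀ n, x n ∈ T → B n ∈ v n) ∧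
    {y | ∃ n m, x n ∈ T ∧ m ∈ B n ∧ F (n, m) = y} ∈ I

section SmallOver

variable {I : Set (Set Cantor)} {v : ℕ → Ultrafilter ℕ} {F : ℕ × ℕ → Cantor} {x : ℕ → Cantor}
  {S T : Set Cantor}

lemma SmallOver.mono (hI : IsIdeal I) (h : SmallOver I v F x T) (hST : S ⊆ T) :
    SmallOver I v F x S := by
  obtain ⟨B, hB, hBI⟩ := h
  refine ⟨B, fun n hn => hB n (hST hn), hI.1 _ _ ?_ hBI⟩
  rintro y ⟨n, m, hn, hm, rfl⟩
  exact ⟨n, m, hST hn, hm, rfl⟩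

lemma SmallOver.union (hI : IsIdeal I) (hS : SmallOver I v F x S) (hT : SmallOver I v F x T) :
    SmallOver I v F x (S ∪ T) := by
  classical
  obtain ⟨B, hB, hBI⟩ := hS
  obtain ⟨C, hC, hCI⟩ := hT
  refine ⟨fun n => if x n ∈ S then B n else C n, fun n hn => ?_,
    hI.1 _ _ ?_ (hI.2 _ _ hBI hCI)⟩
  · by_cases h : x n ∈ S
    · simpa [h] using hB n h
    · simpa [h] using hC n (hn.resolve_left h)
  · rintro y ⟨n, m, hn, hm, rfl⟩
    by_cases h : x n ∈ S
    · exact Or.inl ⟨n, m, h, by simpa [h] using hm, rfl⟩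
    · exact Or.inr ⟨n, m, hn.resolve_left h, by simpa [h] using hm, rfl⟩

lemma SmallOver.iUnion_of_disjoint (hI : DiscreteIdeal I)
    (hx : ∀ n, Tendsto (fun m => F (n, m)) (v n) (𝓝 (x n))) {G : ℕ → Set Cantor}
    (hG : ∀ k, IsOpen (G k)) (hd : Pairwise (Function.onFun Disjoint G))
    (h : ∀ k, SmallOver I v F x (G k ∩ S)) :
    SmallOver I v F x ((⋃ k, G k) ∩ S) := by
  choose B hB hBI using h
  refine ⟨fun n => {m | ∃ k, x n ∈ G k ∧ m ∈ B k n ∧ F (n, m) ∈ G k}, fun n hn => ?_,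
    hI.1.1 _ _ ?_ (hI.2 _ G hBI hG hd)⟩
  · obtain ⟨hn, hnS⟩ := hn
    obtain ⟨k, hk⟩ := mem_iUnion.1 hn
    filter_upwards [hB k n ⟨hk, hnS⟩, hx n ((hG k).mem_nhds hk)] with m hm hm'
    exact ⟨k, hk, hm, hm'⟩
  · rintro y ⟨n, m, hn, ⟨k, hk, hm, hm'⟩, rfl⟩
    exact mem_iUnion.2 ⟨k, ⟨n, m, ⟨hk, hn.2⟩, hm, rfl⟩, hm'⟩

lemma IsIdeal.biUnion_lt_mem (hI : IsIdeal I) (hempty : ∅ ∈ I) {C : ℕ → Set Cantor}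
    (hC : ∀ n, C n ∈ I) (k : ℕ) : (⋃ n < k, C n) ∈ I := by
  induction k with
  | zero => simpa using hempty
  | succ k ih =>
    rw [biUnion_lt_succ]
    exact hI.2 _ _ ih (hC k)

lemma SmallOver.singleton (hI : DiscreteIdeal I) (hsing : ∀ x : Cantor, {x} ∈ I)
    (hv : ∀ n, IUltra I (v n))
    (hx : ∀ n, Tendsto (fun m => F (n, m)) (v n) (𝓝 (x n))) (s : Cantor) :
    SmallOver I v F x {s} := by
  choose C hC hCI using fun n => hv n fun m => F (n, m)
  have hempty : ∅ ∈ I := hI.1.1 _ _ (empty_subset _) (hsing s)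
  have hopen : ∀ n, IsOpen {f : Cantor | ∀ i < n, f i = s i} := fun n => by
    have : {f : Cantor | ∀ i < n, f i = s i} = (Set.Iio n).pi fun i => {s i} := by
      ext f; simp [Set.mem_pi]
    rw [this]
    exact isOpen_set_pi (Set.finite_Iio n) fun _ _ => isOpen_discrete _
  set G : ℕ → Set Cantor := fun k => {f | ∀ i < k, f i = s i} ∩ {f | f k ≠ s k} with hGdef
  have hG : ∀ k, IsOpen (G k) := fun k =>
    (hopen k).inter (isOpen_ne_fun (continuous_apply k) continuous_const)
  have hd : Pairwise (Function.onFun Disjoint G) := by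
    intro j k hjk
    refine Set.disjoint_left.2 fun f hj hk => ?_
    rcases hjk.lt_or_gt with h | h
    · exact hj.2 (hk.1 j h)
    · exact hk.2 (hj.1 k h)
  have key := hI.1.2 _ _ (hsing s)
    (hI.2 _ G (fun k => hI.1.biUnion_lt_mem hempty hCI (k + 1)) hG hd)
  refine ⟨fun n => {m | m ∈ C n ∧ ∀ i < n, F (n, m) i = s i}, fun n hn => ?_,
    hI.1.1 _ _ ?_ key⟩
  · have hn' : x n = s := hn
    have := hx n ((hopen n).mem_nhds (by simp [hn']))
    filter_upwards [hC n, this] with m hm hm'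
    exact ⟨hm, hm'⟩
  · rintro y ⟨n, m, -, ⟨hm, hms⟩, rfl⟩
    by_cases hs : F (n, m) = s
    · exact Or.inl hs
    · right
      have hne : ∃ k, F (n, m) k ≠ s k := Function.ne_iff.1 hs
      classical
      have hlt : n < Nat.find hne + 1 := by
        by_contra! h
        exact Nat.find_spec hne (hms _ h)
      refine mem_iUnion.2 ⟨Nat.find hne, mem_iUnion₂.2 ⟨n, hlt, m, hm, rfl⟩,
        fun i hi => ?_, Nat.find_spec hne⟩
      exact not_not.1 (Nat.find_min hne hi)

lemma SmallOver.of_scattered (hI : DiscreteIdeal I) (hsing : ∀ x : Cantor, {x} ∈ I)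
    (hv : ∀ n, IUltra I (v n))
    (hx : ∀ n, Tendsto (fun m => F (n, m)) (v n) (𝓝 (x n))) (hS : ScatteredSet S) :
    SmallOver I v F x S := by
  have hempty : SmallOver I v F x (∅ ∩ S) :=
    (SmallOver.singleton hI hsing hv hx fun _ => true).mono hI.1 (by simp)
  let 𝒱 : Set (Set Cantor) := {V | IsClopen V ∧ SmallOver I v F x (V ∩ S)}
  have hW : SmallOver I v F x (⋃₀ 𝒱 ∩ S) := by
    obtain ⟨𝒯, h𝒯c, h𝒯, h𝒯U⟩ :=
      TopologicalSpace.isOpen_sUnion_countable 𝒱 fun V hV => hV.1.isOpen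
    obtain ⟨V, hV⟩ := (h𝒯c.insert ∅).exists_eq_range (insert_nonempty _ _)
    have hV𝒱 : ∀ k, V k ∈ 𝒱 := fun k => by
      have hk : V k ∈ insert ∅ 𝒯 := hV ▸ mem_range_self k
      rcases hk with hk | hk
      · rw [hk]
        exact ⟨isClopen_empty, hempty⟩
      · exact h𝒯 hk
    have hUnion : ⋃₀ 𝒱 = ⋃ k, disjointed V k := by
      rw [iUnion_disjointed, ← sUnion_range, ← hV, sUnion_insert, empty_union, h𝒯U]
    have hopen : ∀ k, IsOpen (disjointed V k) := fun k =>
      disjointedRec (p := IsOpen) (fun {_ _} h => IsOpen.sdiff h (hV𝒱 _).1.isClosed) (hV𝒱 k).1.isOpen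
    rw [hUnion]
    exact SmallOver.iUnion_of_disjoint hI hx hopen (disjoint_disjointed V) fun k =>
      (hV𝒱 k).2.mono hI.1 (inter_subset_inter_left _ (disjointed_subset V k))
  suffices h : S ⊆ ⋃₀ 𝒱 from hW.mono hI.1 fun s hs => ⟨h hs, hs⟩
  by_contra h
  obtain ⟨s, hs, U, hU, hUs⟩ := hS (S \ ⋃₀ 𝒱) sdiff_subset (sdiff_nonempty.2 h)
  have hsU : s ∈ U := (hUs.ge rfl).2
  obtain ⟨V, hV, hsV, hVU⟩ := compact_exists_isClopen_in_isOpen hU hsU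
  refine hs.2 (mem_sUnion_of_mem hsV ⟨hV, ?_⟩)
  refine (hW.union hI.1 (SmallOver.singleton hI hsing hv hx s)).mono hI.1 fun t ht => ?_
  by_cases htW : t ∈ ⋃₀ 𝒱
  · exact Or.inl ⟨htW, ht.2⟩
  · exact Or.inr (hUs.le ⟨⟨ht.2, htW⟩, hVU ht.1⟩)

end SmallOver

/-- if `I` is a discrete ideal containing all singletons, then the class of
`I`-ultrafilters is closed under scattered sums. -/
theorem stmt8 (I : Set (Set Cantor)) (hI : DiscreteIdeal I)
    (hsing : ∀ x : Cantor, {x} ∈ I)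
    (v : ℕ → Ultrafilter ℕ) (hv : ∀ n, IUltra I (v n))
    (u : Ultrafilter ℕ) (hu : IUltra {A : Set Cantor | ScatteredSet A} u) :
    IUltra2 I (ultraSum u v) := by
  intro F
  let x : ℕ → Cantor := fun n => ((v n).map fun m => F (n, m)).lim
  have hx : ∀ n, Tendsto (fun m => F (n, m)) (v n) (𝓝 (x n)) := fun n =>
    ((v n).map fun m => F (n, m)).le_nhds_lim
  obtain ⟨A, hA, hS⟩ := hu x
  obtain ⟨B, hB, hBI⟩ := SmallOver.of_scattered hI hsing hv hx hS
  refine ⟨{p | p.1 ∈ A ∧ p.2 ∈ B p.1}, ?_, hI.1.1 _ _ ?_ hBI⟩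
  · change {n | {m | n ∈ A ∧ m ∈ B n} ∈ v n} ∈ u
    filter_upwards [hA] with n hn
    filter_upwards [hB n (mem_image_of_mem x hn)] with m hm
    exact ⟨hn, hm⟩
  · rintro y ⟨⟨n, m⟩, ⟨hn, hm⟩, rfl⟩
    exact ⟨n, m, mem_image_of_mem x hn, hm, rfl⟩
end

section
/- If u and v_n (n ∈ ℕ) are nowhere dense ultrafilters on ℕ, then the sum ∑_u v_n is a nowhere dense ultrafilter on ℕ × ℕ. -/
open Set Topology Filter MeasureTheory

theorem IsNowhereDense.biUnion_finite {X ι : Type*} [TopologicalSpace X] {I : Set ι}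
    (hI : I.Finite) {S : ι → Set X} (hS : ∀ i ∈ I, IsNowhereDense (S i)) :
    IsNowhereDense (⋃ i ∈ I, S i) := by
  induction I, hI using Set.Finite.induction_on with
  | empty => simp
  | @insert a t _ _ ih =>
    rw [Set.biUnion_insert, IsNowhereDense, closure_union,
      interior_union_isClosed_of_interior_empty isClosed_closure
        (ih fun i hi => hS i (Set.mem_insert_of_mem _ hi))]
    exact hS a (Set.mem_insert _ _)

/-- Nowhere dense sets contained in shrinking balls whose centers form a nowhere dense set have
a nowhere dense union. -/
theorem IsNowhereDense.biUnion_of_subset_ball {X : Type*} [PseudoMetricSpace X] {B : Set ℕ}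
    {x : ℕ → X} {r : ℕ → ℝ} {S : ℕ → Set X} (hr : Tendsto r atTop (𝓝 0))
    (hx : IsNowhereDense (x '' B)) (hS : ∀ n ∈ B, IsNowhereDense (S n))
    (hball : ∀ n ∈ B, S n ⊆ Metric.ball (x n) (r n)) :
    IsNowhereDense (⋃ n ∈ B, S n) := by
  by_contra hU
  obtain ⟨z, hz⟩ := Set.nonempty_iff_ne_empty.mpr hU
  have hfar : (interior (closure (⋃ n ∈ B, S n)) ∩ (closure (x '' B))ᶜ).Nonempty :=
    (interior_eq_empty_iff_dense_compl.mp hx).inter_open_nonempty _ isOpen_interior ⟨z, hz⟩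
  obtain ⟨y, hy⟩ := hfar
  obtain ⟨ε, hε, hsub⟩ := Metric.isOpen_iff.mp
    (isOpen_interior.inter isClosed_closure.isOpen_compl) y hy
  obtain ⟨N, hN⟩ := eventually_atTop.mp (hr.eventually_lt_const (half_pos hε))
  have hT : IsNowhereDense (⋃ n ∈ B ∩ Set.Iio N, S n) :=
    IsNowhereDense.biUnion_finite ((Set.finite_Iio N).inter_of_right B) fun n hn => hS n hn.1
  have hlocal : Metric.ball y (ε / 2) ∩ (⋃ n ∈ B, S n) ⊆ ⋃ n ∈ B ∩ Set.Iio N, S n := by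
    rintro w ⟨hwy, hw⟩
    obtain ⟨n, hn, hwn⟩ := Set.mem_iUnion₂.mp hw
    refine Set.mem_biUnion ⟨hn, ?_⟩ hwn
    by_contra hNn
    have hxy : x n ∈ Metric.ball y ε := by
      have h₁ := Metric.mem_ball'.mp (hball n hn hwn)
      have h₂ := Metric.mem_ball.mp hwy
      have h₃ := hN n (not_lt.mp hNn)
      have h₄ := dist_triangle (x n) w y
      exact Metric.mem_ball.mpr (by linarith)
    exact (hsub hxy).2 (subset_closure (Set.mem_image_of_mem x hn))
  have hcl : Metric.ball y (ε / 2) ⊆ closure (⋃ n ∈ B ∩ Set.Iio N, S n) := fun w hw =>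
    closure_mono hlocal <| Metric.isOpen_ball.inter_closure
      ⟨hw, interior_subset (hsub (Metric.ball_subset_ball (half_le_self hε.le) hw)).1⟩
  have hmem : y ∈ interior (closure (⋃ n ∈ B ∩ Set.Iio N, S n)) :=
    interior_maximal hcl Metric.isOpen_ball (Metric.mem_ball_self (half_pos hε))
  rw [hT] at hmem
  exact hmem

theorem mem_ultraSum {u : Ultrafilter ℕ} {v : ℕ → Ultrafilter ℕ} {A : Set (ℕ × ℕ)} :
    A ∈ ultraSum u v ↔ {n | {m | (n, m) ∈ A} ∈ v n} ∈ u :=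
  Iff.rfl

/-- the nowhere dense ultrafilters are closed under nowhere dense sums. -/
theorem stmt9 (u : Ultrafilter ℕ) (v : ℕ → Ultrafilter ℕ)
    (hu : IUltra {A : Set Cantor | IsNowhereDense A} u)
    (hv : ∀ n, IUltra {A : Set Cantor | IsNowhereDense A} (v n)) :
    IUltra2 {A : Set Cantor | IsNowhereDense A} (ultraSum u v) := by
  intro F
  let _ : MetricSpace Cantor := TopologicalSpace.metrizableSpaceMetric Cantor
  choose A hA hFA using fun n => hv n fun m => F (n, m)
  let x : ℕ → Cantor := fun n => ((v n).map fun m => F (n, m)).lim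
  obtain ⟨B, hB, hxB⟩ := hu x
  let C : ℕ → Set ℕ := fun n =>
    A n ∩ (fun m => F (n, m)) ⁻¹' Metric.ball (x n) (1 / ((n : ℝ) + 1))
  have hC : ∀ n, C n ∈ v n := fun n =>
    Filter.inter_mem (hA n) (((v n).map fun m => F (n, m)).le_nhds_lim
      (Metric.ball_mem_nhds (x n) Nat.one_div_pos_of_nat))
  refine ⟨{p | p.1 ∈ B ∧ p.2 ∈ C p.1}, mem_ultraSum.mpr ?_, ?_⟩
  · filter_upwards [hB] with n hn
    filter_upwards [hC n] with m hm using ⟨hn, hm⟩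
  · have hnd : IsNowhereDense (⋃ n ∈ B, (fun m => F (n, m)) '' C n) :=
      IsNowhereDense.biUnion_of_subset_ball tendsto_one_div_add_atTop_nhds_zero_nat hxB
        (fun n _ => (hFA n).mono (Set.image_mono Set.inter_subset_left))
        (fun n _ => Set.image_subset_iff.mpr Set.inter_subset_right)
    refine hnd.mono ?_
    rintro _ ⟨⟨n, m⟩, ⟨hn, hm⟩, rfl⟩
    exact Set.mem_biUnion hn (Set.mem_image_of_mem _ hm)
end

section
/- If u and v_n (n ∈ ℕ) are measure zero ultrafilters on ℕ, then the sum ∑_u v_n is a measure zero ultrafilter on ℕ × ℕ. -/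
open Set Topology Filter MeasureTheory

/-- If the sets `D n`, `n ∈ B`, lie in cylinders of depth `n` around points `x n`, then every
limit point of their union is a limit point of the centres or of a single `D n`. -/
theorem closure_biUnion_subset_of_subset_cylinder (B : Set ℕ) (x : ℕ → Cantor)
    (D : ℕ → Set Cantor) (hD : ∀ n, D n ⊆ PiNat.cylinder (x n) n) :
    closure (⋃ n ∈ B, D n) ⊆ closure (x '' B) ∪ ⋃ n, closure (D n) := by
  intro y hy
  by_contra hy'
  simp only [mem_union, mem_iUnion, not_or, not_exists] at hy'
  obtain ⟨hyx, hyD⟩ := hy'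
  obtain ⟨_, ⟨z, k, rfl⟩, hyz, hsub⟩ :=
    (PiNat.isTopologicalBasis_cylinders fun _ : ℕ => Bool).exists_subset_of_mem_open
      (show y ∈ (closure (x '' B))ᶜ from hyx) isClosed_closure.isOpen_compl
  have hopen : IsOpen (PiNat.cylinder z k ∩ (⋃ n ∈ Finset.range k, closure (D n))ᶜ) :=
    (PiNat.isOpen_cylinder _ z k).inter
      (isClosed_biUnion_finset fun _ _ => isClosed_closure).isOpen_compl
  obtain ⟨w, ⟨hwz, hw⟩, hwD⟩ := mem_closure_iff.1 hy _ hopen ⟨hyz, by simpa using fun n _ => hyD n⟩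
  simp only [mem_iUnion] at hwD
  obtain ⟨n, hn, hwn⟩ := hwD
  have hkn : k ≤ n := by
    by_contra! h
    exact hw (mem_biUnion (Finset.mem_coe.2 (Finset.mem_range.2 h)) (subset_closure hwn))
  refine hsub (fun i hi => ?_) (subset_closure ⟨n, hn, rfl⟩)
  exact (hD n hwn i (hi.trans_le hkn)).symm.trans (hwz i hi)

/-- the measure zero ultrafilters are closed under measure zero sums
(for the coin-flipping measure `μ` on `2^ω`, characterized by its values on cylinders). -/
theorem stmt10 (μ : Measure Cantor)
    (hμ : ∀ s : List Bool, μ (cyl s) = (2⁻¹ : ENNReal) ^ s.length)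
    (u : Ultrafilter ℕ) (v : ℕ → Ultrafilter ℕ)
    (hu : IUltra {A : Set Cantor | μ (closure A) = 0} u)
    (hv : ∀ n, IUltra {A : Set Cantor | μ (closure A) = 0} (v n)) :
    IUltra2 {A : Set Cantor | μ (closure A) = 0} (ultraSum u v) := by
  intro F
  have hlim : ∀ n, ∃ x : Cantor, Tendsto (fun m => F (n, m)) (v n) (𝓝 x) := fun n => by
    obtain ⟨x, -, hx⟩ := isCompact_univ.ultrafilter_le_nhds ((v n).map fun m => F (n, m)) (by simp)
    exact ⟨x, hx⟩
  choose x hx using hlim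
  choose A hA hA0 using fun n => hv n fun m => F (n, m)
  obtain ⟨B, hB, hB0⟩ := hu x
  set A' : ℕ → Set ℕ := fun n => A n ∩ (fun m => F (n, m)) ⁻¹' PiNat.cylinder (x n) n
  have hA' : ∀ n, A' n ∈ v n := fun n => inter_mem (hA n)
    (hx n ((PiNat.isOpen_cylinder _ _ _).mem_nhds (PiNat.self_mem_cylinder _ _)))
  set D : ℕ → Set Cantor := fun n => (fun m => F (n, m)) '' A' n
  refine ⟨{p | p.1 ∈ B ∧ p.2 ∈ A' p.1}, ?_, ?_⟩
  · change {n | {m | n ∈ B ∧ m ∈ A' n} ∈ v n} ∈ u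
    filter_upwards [hB] with n hn
    filter_upwards [hA' n] with m hm using ⟨hn, hm⟩
  · have hsub : F '' {p | p.1 ∈ B ∧ p.2 ∈ A' p.1} ⊆ ⋃ n ∈ B, D n := by
      rintro _ ⟨⟨n, m⟩, ⟨hn, hm⟩, rfl⟩
      exact mem_biUnion hn ⟨m, hm, rfl⟩
    have hD : ∀ n, D n ⊆ PiNat.cylinder (x n) n := by
      rintro n _ ⟨m, hm, rfl⟩
      exact hm.2
    refine measure_mono_null ((closure_mono hsub).trans
      (closure_biUnion_subset_of_subset_cylinder B x D hD)) (measure_union_null hB0 ?_)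
    exact measure_iUnion_null fun n =>
      measure_mono_null (closure_mono (image_mono inter_subset_left)) (hA0 n)
end

section
/- For every nonprincipal ultrafilter u on ℕ and every bijection e : ℕ × ℕ ≃ ℕ used to form the finite powers u^n, the ultrafilter u^ω on ℕ × ℕ is not a discrete ultrafilter. -/
open Set Topology Filter MeasureTheory

/-- The indicator of the set of coordinates of the `n`-tuple coded by `x` through `e`. -/
def coordIndicator (e : ℕ × ℕ ≃ ℕ) : ℕ → ℕ → Cantor
  | 0, _ => fun _ => false
  | n + 1, x => fun i => decide (i = (e.symm x).1) || coordIndicator e n (e.symm x).2 i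

theorem coordIndicator_succ_apply (e : ℕ × ℕ ≃ ℕ) (n k x i : ℕ) :
    coordIndicator e (n + 1) (e (k, x)) i = (decide (i = k) || coordIndicator e n x i) := by
  simp [coordIndicator]

theorem mem_ultraSum_iff {u : Ultrafilter ℕ} {v : ℕ → Ultrafilter ℕ} {S : Set (ℕ × ℕ)} :
    S ∈ ultraSum u v ↔ {n | {m | (n, m) ∈ S} ∈ v n} ∈ u :=
  Iff.rfl

theorem mem_ultraPow_succ_iff {e : ℕ × ℕ ≃ ℕ} {u : Ultrafilter ℕ} {n : ℕ} {S : Set ℕ} :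
    S ∈ ultraPow e u (n + 1) ↔ {k | {x | e (k, x) ∈ S} ∈ ultraPow e u n} ∈ u :=
  Iff.rfl

theorem Ici_mem_of_ne_pure {u : Ultrafilter ℕ} (hnp : ∀ a : ℕ, u ≠ pure a) (N : ℕ) :
    Set.Ici N ∈ u := by
  by_contra h
  have hfin : (Set.Ici N)ᶜ.Finite := by
    rw [Set.compl_Ici]
    exact Set.finite_Iio N
  obtain ⟨a, -, ha⟩ :=
    Ultrafilter.eq_pure_of_finite_mem hfin (Ultrafilter.compl_mem_iff_notMem.mpr h)
  exact hnp a ha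

theorem coordIndicator_eventually_false_below {u : Ultrafilter ℕ} (hnp : ∀ a : ℕ, u ≠ pure a)
    (e : ℕ × ℕ ≃ ℕ) (N n : ℕ) :
    {x | ∀ i < N, coordIndicator e n x i = false} ∈ ultraPow e u n := by
  induction n with
  | zero => exact Filter.univ_mem' fun x i _ => rfl
  | succ n ih =>
    rw [mem_ultraPow_succ_iff]
    filter_upwards [Ici_mem_of_ne_pure hnp N] with k hk
    filter_upwards [ih] with x hx i hi
    have hik : i ≠ k := (lt_of_lt_of_le hi hk).ne
    simp [coordIndicator_succ_apply, hik, hx i hi]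

theorem exists_coordIndicator_accumulation {u : Ultrafilter ℕ} (hnp : ∀ a : ℕ, u ≠ pure a)
    (e : ℕ × ℕ ≃ ℕ) (d n : ℕ) {C D : Set ℕ} (hC : C ∈ ultraPow e u n)
    (hD : D ∈ ultraPow e u (d + 1 + n)) :
    ∃ x ∈ C, ∀ N, ∃ y ∈ D,
      (∀ i < N, coordIndicator e (d + 1 + n) y i = coordIndicator e n x i) ∧
      ∃ j ≥ N, coordIndicator e (d + 1 + n) y j = true ∧ coordIndicator e n x j = false := by
  induction n generalizing C D with
  | zero =>
    refine ⟨0, hC, fun N => ?_⟩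
    obtain ⟨y, hyD, hy⟩ := Ultrafilter.nonempty_of_mem
      (Filter.inter_mem hD (coordIndicator_eventually_false_below hnp e N (d + 1)))
    have hj : coordIndicator e (d + 1) y (e.symm y).1 = true := by simp [coordIndicator]
    refine ⟨y, hyD, hy, (e.symm y).1, ?_, hj, rfl⟩
    by_contra! hlt
    simp [hy _ hlt] at hj
  | succ n ih =>
    obtain ⟨k, hkC, hkD⟩ := Ultrafilter.nonempty_of_mem
      (Filter.inter_mem (mem_ultraPow_succ_iff.mp hC)
        (mem_ultraPow_succ_iff (n := d + 1 + n).mp hD))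
    obtain ⟨x, hx, H⟩ := ih hkC hkD
    refine ⟨e (k, x), hx, fun N => ?_⟩
    obtain ⟨y, hy, hagree, j, hj, hjy, hjx⟩ := H (max N (k + 1))
    have hjk : j ≠ k := by omega
    refine ⟨e (k, y), hy, fun i hi => ?_, j, by omega, ?_, ?_⟩
    · rw [← add_assoc, coordIndicator_succ_apply, coordIndicator_succ_apply,
        hagree i (by omega)]
    · rw [← add_assoc, coordIndicator_succ_apply, hjy, Bool.or_true]
    · simp [coordIndicator_succ_apply, hjk, hjx]

theorem exists_forall_eq_below_mem_of_isOpen {U : Set Cantor} (hU : IsOpen U) {f : Cantor}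
    (hf : f ∈ U) : ∃ N, ∀ g : Cantor, (∀ i < N, g i = f i) → g ∈ U := by
  obtain ⟨I, V, hV, hIV⟩ := isOpen_pi_iff.mp hU f hf
  refine ⟨I.sup id + 1, fun g hg => hIV fun i hi => ?_⟩
  rw [hg i (Nat.lt_succ_of_le (Finset.le_sup (f := id) hi))]
  exact (hV i hi).2

/-- for any nonprincipal ultrafilter `u`, `u^ω` is not discrete. -/
theorem stmt11 (u : Ultrafilter ℕ) (hnp : ∀ a : ℕ, u ≠ pure a) (e : ℕ × ℕ ≃ ℕ) :
    ¬ IUltra2 {A : Set Cantor | DiscreteSet A} (ultraPowOmega e u) := by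
  intro h
  obtain ⟨A, hA, hdisc⟩ := h fun p => coordIndicator e p.1 p.2
  have hB := mem_ultraSum_iff.mp hA
  obtain ⟨n, hn⟩ := Ultrafilter.nonempty_of_mem hB
  obtain ⟨m, hm, hnm⟩ := Ultrafilter.nonempty_of_mem
    (Filter.inter_mem hB (Ici_mem_of_ne_pure hnp (n + 1)))
  obtain ⟨d, rfl⟩ : ∃ d, m = d + 1 + n :=
    ⟨m - (n + 1), by have : n + 1 ≤ m := hnm; omega⟩
  obtain ⟨x, hx, H⟩ := exists_coordIndicator_accumulation hnp e d n hn hm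
  obtain ⟨U, hU, hAU⟩ := hdisc _ ⟨(n, x), hx, rfl⟩
  have hxU : coordIndicator e n x ∈ U := (hAU.ge rfl).2
  obtain ⟨N, hN⟩ := exists_forall_eq_below_mem_of_isOpen hU hxU
  obtain ⟨y, hy, hagree, j, -, hjy, hjx⟩ := H N
  have heq : coordIndicator e (d + 1 + n) y = coordIndicator e n x :=
    hAU.le ⟨⟨(d + 1 + n, y), hy, rfl⟩, hN _ hagree⟩
  rw [heq, hjx] at hjy
  exact Bool.false_ne_true hjy
end

section
/- For every k ∈ ℕ, every level ≤ k ultrafilter on ℕ is a discrete ultrafilter. -/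
open Set Topology Filter MeasureTheory

/-- The isolated points of a subset of Cantor space form a discrete set. -/
theorem discreteSet_sep_not_accPt (B : Set Cantor) :
    DiscreteSet {x ∈ B | ¬ AccPt x (𝓟 B)} := by
  rintro x ⟨hxB, hx⟩
  rw [accPt_iff_nhds] at hx
  push Not at hx
  obtain ⟨U, hU, h⟩ := hx
  obtain ⟨V, hVU, hVo, hxV⟩ := mem_nhds_iff.mp hU
  refine ⟨V, hVo, Subset.antisymm ?_ ?_⟩
  · rintro y ⟨⟨hyB, -⟩, hyV⟩
    exact h y ⟨hVU hyV, hyB⟩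
  · rintro y rfl
    exact ⟨⟨hxB, by rw [accPt_iff_nhds]; push Not; exact ⟨U, hU, h⟩⟩, hxV⟩

/-- If `F` maps some member of `u` to a set of finite level, then it maps some member of `u` to
a discrete set. -/
theorem exists_discreteSet_image_of_hasLevelLE (u : Ultrafilter ℕ) (F : ℕ → Cantor) (k : ℕ) :
    ∀ A ∈ u, HasLevelLE k (F '' A) → ∃ B ∈ u, DiscreteSet (F '' B) := by
  induction k with
  | zero =>
    intro A hA h
    exact absurd (image_eq_empty.mp h) (u.nonempty_of_mem hA).ne_empty
  | succ k ih =>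
    intro A hA h
    set E : Set Cantor := {x | AccPt x (𝓟 (F '' A))}
    rcases u.mem_or_compl_mem (F ⁻¹' E) with hE | hE
    · refine ih (A ∩ F ⁻¹' E) (inter_mem hA hE) ?_
      rw [image_inter_preimage]
      exact h
    · refine ⟨A ∩ F ⁻¹' Eᶜ, inter_mem hA hE, ?_⟩
      rw [image_inter_preimage]
      exact discreteSet_sep_not_accPt (F '' A)

/-- for `k < ω`, every level `≤ k` ultrafilter is discrete. -/
theorem stmt13 (k : ℕ) (u : Ultrafilter ℕ)
    (hu : IUltra {A : Set Cantor | HasLevelLE k A} u) :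
    IUltra {A : Set Cantor | DiscreteSet A} u := by
  intro F
  obtain ⟨A, hA, h⟩ := hu F
  exact exists_discreteSet_image_of_hasLevelLE u F k A hA h
end

section
/- A nonprincipal ultrafilter u on ℕ is an ω-ultrafilter (that is, an I_ω-ultrafilter) if and only if u is a P-point. -/
open Set Topology Filter MeasureTheory

theorem finite_lt_iff_typein_lt_omega0 (X : Set Ordinal) (x : X) :
    {y ∈ X | y < x}.Finite ↔ Ordinal.typein ((· < ·) : X → X → Prop) x < Ordinal.omega0 := by
  rw [← Ordinal.card_lt_aleph0, Ordinal.card_typein, Cardinal.lt_aleph0_iff_finite]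
  change _ ↔ Finite {y : X | y < x}
  rw [Set.finite_coe_iff, ← Set.finite_image_iff Subtype.val_injective.injOn]
  refine iff_of_eq (congrArg Set.Finite ?_)
  ext y
  constructor
  · rintro ⟨hy, hlt⟩
    exact ⟨⟨y, hy⟩, hlt, rfl⟩
  · rintro ⟨z, hz, rfl⟩
    exact ⟨z.2, hz⟩

/-- A set of ordinals has order type at most `ω` iff its proper initial segments are finite. -/
theorem tp_le_omega0_iff (X : Set Ordinal) :
    tp X ≤ Ordinal.omega0 ↔ ∀ x ∈ X, {y ∈ X | y < x}.Finite := by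
  constructor
  · intro h x hx
    exact (finite_lt_iff_typein_lt_omega0 X ⟨x, hx⟩).2
      ((Ordinal.typein_lt_type _ _).trans_le h)
  · intro h
    by_contra! hlt
    obtain ⟨x, hx⟩ := Ordinal.typein_surj ((· < ·) : X → X → Prop) hlt
    exact ((finite_lt_iff_typein_lt_omega0 X x).1 (h x x.2)).ne hx

theorem omega0_mul_add_lt_omega1 (a b : ℕ) : Ordinal.omega0 * a + b < omega1 := by
  rw [omega1, Cardinal.lt_ord]
  refine lt_of_le_of_lt ?_ Cardinal.aleph0_lt_aleph_one
  simp only [Ordinal.card_add, Ordinal.card_mul, Ordinal.card_omega0, Ordinal.card_nat]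
  exact Cardinal.add_le_aleph0.2 ⟨(mul_le_mul_right Cardinal.natCast_le_aleph0 _).trans
    Cardinal.aleph0_mul_aleph0.le, Cardinal.natCast_le_aleph0⟩

theorem omega0_mul_add_lt {a b : ℕ} (h : a < b) (k l : ℕ) :
    Ordinal.omega0 * a + k < Ordinal.omega0 * b + l := by
  calc Ordinal.omega0 * a + k < Ordinal.omega0 * a + Ordinal.omega0 := by
        gcongr
        exact Ordinal.natCast_lt_omega0 k
    _ = Ordinal.omega0 * (a + 1 : ℕ) := by rw [Nat.cast_add, Nat.cast_one, mul_add_one]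
    _ ≤ Ordinal.omega0 * b := by gcongr; exact h
    _ ≤ Ordinal.omega0 * b + l := le_self_add

theorem omega0_mul_add_injective (g : ℕ → ℕ) :
    Function.Injective fun k : ℕ => Ordinal.omega0 * (g k : Ordinal) + k := by
  intro k l h
  rcases lt_trichotomy (g k) (g l) with hg | hg | hg
  · exact absurd h (omega0_mul_add_lt hg k l).ne
  · simpa [hg] using h
  · exact absurd h (omega0_mul_add_lt hg l k).ne'

theorem AlphaUltra.exists_pseudoIntersection {u : Ultrafilter ℕ}
    (hu : AlphaUltra Ordinal.omega0 u) (A : ℕ → Set ℕ) (hA : ∀ n, A n ∈ u) :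
    ∃ B ∈ u, ∀ n, (B \ A n).Finite := by
  by_cases hI : (⋂ n, A n) ∈ u
  · refine ⟨_, hI, fun n => ?_⟩
    rw [Set.sdiff_eq_empty.2 (Set.iInter_subset A n)]
    exact Set.finite_empty
  set g : ℕ → ℕ := fun k => sInf {n | k ∉ A n}
  obtain ⟨C, hC, hCtp⟩ := hu (fun k => Ordinal.omega0 * (g k : Ordinal) + k)
    fun k => omega0_mul_add_lt_omega1 _ _
  rw [tp_le_omega0_iff] at hCtp
  refine ⟨C ∩ (⋂ n, A n)ᶜ, inter_mem hC (Ultrafilter.compl_mem_iff_notMem.2 hI), fun n => ?_⟩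
  have hmem : (C ∩ (⋂ n, A n)ᶜ) ∩ ⋂ i ∈ Set.Iic n, A i ∈ u :=
    inter_mem (inter_mem hC (Ultrafilter.compl_mem_iff_notMem.2 hI))
      ((biInter_mem (Set.finite_Iic n)).2 fun i _ => hA i)
  obtain ⟨k₀, ⟨hk₀C, hk₀I⟩, hk₀A⟩ := u.nonempty_of_mem hmem
  have hk₀ : n < g k₀ := by
    have hne : {m | k₀ ∉ A m}.Nonempty := by
      simpa [Set.Nonempty] using hk₀I
    by_contra! hle
    exact Nat.sInf_mem hne (Set.mem_iInter₂.1 hk₀A _ hle)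
  refine Set.Finite.of_finite_image
    ((hCtp _ (Set.mem_image_of_mem _ hk₀C)).subset ?_) (omega0_mul_add_injective g).injOn
  rintro _ ⟨k, ⟨⟨hkC, -⟩, hkA⟩, rfl⟩
  exact ⟨⟨k, hkC, rfl⟩, omega0_mul_add_lt ((Nat.sInf_le hkA).trans_lt hk₀) k k₀⟩

theorem IsPPoint.alphaUltra_omega0 {u : Ultrafilter ℕ} (hu : IsPPoint u) :
    AlphaUltra Ordinal.omega0 u := by
  intro F _
  have hex : ∃ γ, {n | F n ≤ γ} ∈ u := by
    obtain ⟨γ, hγ⟩ := Ordinal.bddAbove_of_small (s := Set.range F)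
    exact ⟨γ, Filter.mem_of_superset univ_mem fun n _ => hγ ⟨n, rfl⟩⟩
  obtain ⟨γ, hγ, hmin⟩ := WellFounded.has_min (wellFounded_lt (α := Ordinal))
    {γ | {n | F n ≤ γ} ∈ u} hex
  by_cases heq : {n | F n = γ} ∈ u
  · refine ⟨_, heq, (tp_le_omega0_iff _).2 fun x _ => (Set.finite_singleton γ).subset ?_⟩
    rintro _ ⟨⟨n, hn, rfl⟩, -⟩
    exact hn
  have hlt : {n | F n < γ} ∈ u := by
    filter_upwards [hγ, Ultrafilter.compl_mem_iff_notMem.2 heq] with n h₁ h₂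
    exact lt_of_le_of_ne h₁ h₂
  obtain ⟨B, hB, hfin⟩ := hu.2 (fun m => {n | F m < γ → F m < F n}) fun m => by
    by_cases hm : F m < γ
    · have hnot : {n | F n ≤ F m} ∉ u := fun h => hmin _ h hm
      filter_upwards [Ultrafilter.compl_mem_iff_notMem.2 hnot] with n hn _
      exact not_le.1 hn
    · exact Filter.mem_of_superset univ_mem fun n _ h => absurd h hm
  refine ⟨B ∩ {n | F n < γ}, inter_mem hB hlt, (tp_le_omega0_iff _).2 ?_⟩
  rintro _ ⟨m, ⟨-, hm⟩, rfl⟩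
  refine ((hfin m).image F).subset ?_
  rintro _ ⟨⟨n, ⟨hnB, -⟩, rfl⟩, hnm⟩
  exact ⟨n, ⟨hnB, fun h => (h hm).not_gt hnm⟩, rfl⟩

/-- the `ω`-ultrafilters are exactly the P-points. -/
theorem stmt15 (u : Ultrafilter ℕ) (hnp : ∀ a : ℕ, u ≠ pure a) :
    AlphaUltra Ordinal.omega0 u ↔ IsPPoint u := by
  exact ⟨fun h => ⟨hnp, h.exists_pseudoIntersection⟩, IsPPoint.alphaUltra_omega0⟩
end

section
/- If there exists a P-point ultrafilter on ℕ, then for every ordinal α < ω₁ there exists a proper ω^α-ultrafilter on ℕ (where ω^α denotes ordinal exponentiation). -/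
open Set Topology Filter MeasureTheory

section OrderType

open Ordinal

universe u

theorem tp_le_of_strictMonoOn {X Y : Set Ordinal.{u}} {f : Ordinal.{u} → Ordinal.{u}}
    (hf : StrictMonoOn f X) (h : MapsTo f X Y) : tp X ≤ tp Y :=
  type_le_iff'.2 ⟨RelEmbedding.ofMonotone (fun x => ⟨f x, h x.2⟩)
    fun x y hxy => hf x.2 y.2 hxy⟩

theorem tp_mono {X Y : Set Ordinal.{u}} (h : X ⊆ Y) : tp X ≤ tp Y :=
  tp_le_of_strictMonoOn (f := id) strictMonoOn_id h

@[simp]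
theorem tp_eq_zero {X : Set Ordinal.{u}} : tp X = 0 ↔ X = ∅ := by
  rw [tp, type_eq_zero_iff_isEmpty, isEmpty_coe_sort]

theorem one_le_tp {X : Set Ordinal.{u}} : 1 ≤ tp X ↔ X.Nonempty := by
  rw [Order.one_le_iff_ne_zero, Ne, tp_eq_zero, nonempty_iff_ne_empty]

theorem tp_union_of_lt {X Y : Set Ordinal.{u}} (h : ∀ x ∈ X, ∀ y ∈ Y, x < y) :
    tp (X ∪ Y) = tp X + tp Y := by
  have hd : Disjoint X Y := disjoint_left.2 fun x hx hy => lt_irrefl x (h x hx x hy)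
  rw [tp, tp, tp, ← type_sum_lex]
  refine (RelIso.ordinalType_congr ?_).symm
  classical
  refine ⟨(Equiv.Set.union hd).symm, ?_⟩
  rintro (⟨x, hx⟩ | ⟨x, hx⟩) (⟨y, hy⟩ | ⟨y, hy⟩)
  · simp
  · simpa using h x hx y hy
  · simpa using (h y hy x hx).le
  · simp

theorem tp_eq_Iio_add_Ici (X : Set Ordinal.{u}) (z : Ordinal.{u}) :
    tp X = tp (X ∩ Iio z) + tp (X ∩ Ici z) := by
  rw [← tp_union_of_lt fun x hx y hy => hx.2.trans_le hy.2, ← inter_union_distrib_left,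
    Iio_union_Ici, inter_univ]

theorem exists_tp_Iio_eq {X : Set Ordinal.{u}} {c : Ordinal.{u + 1}} (h : c < tp X) :
    ∃ z ∈ X, tp (X ∩ Iio z) = c := by
  obtain ⟨z, rfl⟩ := typein_surj _ h
  refine ⟨z, z.2, RelIso.ordinalType_congr (α := ↥(X ∩ Iio (z : Ordinal)))
    (β := {y : X // y < z}) ⟨⟨fun x => ⟨⟨x, x.2.1⟩, x.2.2⟩, fun y => ⟨y.1, y.1.2, y.2⟩,
      fun _ => rfl, fun _ => rfl⟩, Iff.rfl⟩⟩

theorem tp_le_of_forall {X : Set Ordinal.{u}} {c : Ordinal.{u + 1}}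
    (h : ∀ z ∈ X, tp (X ∩ Iio z) < c) : tp X ≤ c := by
  by_contra! hc
  obtain ⟨z, hz, rfl⟩ := exists_tp_Iio_eq hc
  exact lt_irrefl _ (h z hz)

/-- If unions of two sets of type `< c` have type `< c`, then sets of type `< c * (a + 1)` and
`< c * (b + 1)` have a union of type `< c * (a + b + 1)`. -/
theorem tp_union_lt_mul {c : Ordinal.{u + 1}}
    (hc : ∀ X Y : Set Ordinal.{u}, tp X < c → tp Y < c → tp (X ∪ Y) < c) :
    ∀ (n a b : ℕ), a + b = n → ∀ X Y : Set Ordinal.{u}, tp X < c * (a + 1 : ℕ) →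
      tp Y < c * (b + 1 : ℕ) → tp (X ∪ Y) < c * (n + 1 : ℕ) := by
  intro n
  induction n with
  | zero =>
    intro a b hab X Y hX hY
    obtain ⟨rfl, rfl⟩ : a = 0 ∧ b = 0 := by omega
    simpa using hc X Y (by simpa using hX) (by simpa using hY)
  | succ n ih =>
    intro a b hab X Y hX hY
    have mul_succ' (k : ℕ) : c * ((k + 1 : ℕ) : Ordinal) = c + c * k := by
      rw [add_comm k, Nat.cast_add, Nat.cast_one, mul_add, mul_one]
    have tail_lt {W : Set Ordinal.{u}} {z : Ordinal.{u}} {k : ℕ}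
        (hW : tp W < c * (k + 1 : ℕ)) (hz : c ≤ tp (W ∩ Iio z)) :
        ∃ l, k = l + 1 ∧ tp (W ∩ Ici z) < c * (l + 1 : ℕ) := by
      rw [tp_eq_Iio_add_Ici W z, mul_succ'] at hW
      have h2 : tp (W ∩ Ici z) < c * k := by
        by_contra! hle
        exact absurd hW (not_lt.2 (add_le_add hz hle))
      cases k with
      | zero => simp at h2
      | succ l => exact ⟨l, rfl, h2⟩
    rcases le_or_gt (tp (X ∪ Y)) c with hle | hlt
    · have hpos : 0 < c := by
        by_contra! h0
        rw [nonpos_iff_eq_zero.1 h0] at hX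
        simp at hX
      refine hle.trans_lt ?_
      have : c * (1 : ℕ) < c * (n + 1 + 1 : ℕ) :=
        mul_lt_mul_of_pos_left (Nat.cast_lt.2 (by omega)) hpos
      simpa using this
    obtain ⟨z, -, hz⟩ := exists_tp_Iio_eq hlt
    rw [tp_eq_Iio_add_Ici _ z, hz, mul_succ', add_lt_add_iff_left, union_inter_distrib_right]
    rw [union_inter_distrib_right] at hz
    by_cases hXz : tp (X ∩ Iio z) < c
    · have hYz : c ≤ tp (Y ∩ Iio z) := by
        by_contra! hYz
        exact (hc _ _ hXz hYz).ne hz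
      obtain ⟨l, rfl, hl⟩ := tail_lt hY hYz
      exact ih a l (by omega) _ _ ((tp_mono inter_subset_left).trans_lt hX) hl
    · obtain ⟨l, rfl, hl⟩ := tail_lt hX (not_lt.1 hXz)
      exact ih l b (by omega) _ _ hl ((tp_mono inter_subset_left).trans_lt hY)

theorem tp_union_lt_opow (α : Ordinal.{u + 1}) :
    ∀ X Y : Set Ordinal.{u}, tp X < ω ^ α → tp Y < ω ^ α → tp (X ∪ Y) < ω ^ α := by
  induction α using WellFoundedLT.induction with
  | ind α ih =>
    intro X Y hX hY
    rcases eq_or_ne α 0 with rfl | hα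
    · rw [opow_zero, Order.lt_one_iff, tp_eq_zero] at *
      simp [hX, hY]
    obtain ⟨c, hc, m, hm⟩ := (lt_omega0_opow hα).1 hX
    obtain ⟨d, hd, n, hn⟩ := (lt_omega0_opow hα).1 hY
    have key {e : Ordinal.{u + 1}} {Z : Set Ordinal.{u}} {k : ℕ} (he : e ≤ max c d)
        (h : tp Z < ω ^ e * k) : tp Z < ω ^ (max c d) * (k + 1 : ℕ) :=
      h.trans_le (mul_le_mul' (opow_le_opow_right omega0_pos he) (Nat.cast_le.2 k.le_succ))
    exact (lt_omega0_opow hα).2 ⟨max c d, max_lt hc hd, _,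
      tp_union_lt_mul (ih _ (max_lt hc hd)) (m + n) m n rfl X Y
        (key (le_max_left _ _) hm) (key (le_max_right _ _) hn)⟩

theorem tp_biUnion_lt_opow {α : Ordinal.{u + 1}} {ι : Type*} {T : Set ι} (hT : T.Finite)
    {X : ι → Set Ordinal.{u}} (hX : ∀ i ∈ T, tp (X i) < ω ^ α) :
    tp (⋃ i ∈ T, X i) < ω ^ α := by
  induction T, hT using Set.Finite.induction_on with
  | empty => simp [tp_eq_zero.2, opow_pos]
  | @insert a s _ _ ih =>
    rw [biUnion_insert]
    exact tp_union_lt_opow α _ _ (hX a (mem_insert _ _))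
      (ih fun i hi => hX i (mem_insert_of_mem _ hi))

theorem mul_natCast_le_tp_iUnion {X : ℕ → Set Ordinal.{u}}
    (hX : ∀ i j, i < j → ∀ x ∈ X i, ∀ y ∈ X j, x < y) {c : Ordinal.{u + 1}}
    (hc : ∀ N, ∃ n ≥ N, c ≤ tp (X n)) (k N : ℕ) : c * k ≤ tp (⋃ n ≥ N, X n) := by
  induction k generalizing N with
  | zero => simp
  | succ k ih =>
    obtain ⟨n, hn, hcn⟩ := hc N
    rw [add_comm k, Nat.cast_add, Nat.cast_one, mul_add, mul_one]
    refine (add_le_add hcn (ih (n + 1))).trans ?_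
    rw [← tp_union_of_lt]
    · refine tp_mono (union_subset (subset_biUnion_of_mem (u := X) hn) ?_)
      exact biUnion_mono (fun i hi => (hn.trans (Nat.le_succ n)).trans hi) fun _ _ => Subset.rfl
    · intro x hx y hy
      obtain ⟨j, hj, hy⟩ := mem_iUnion₂.1 hy
      exact hX n j hj x hx y hy

theorem opow_le_tp_iUnion {α : Ordinal.{u + 1}} (hα : α ≠ 0) {X : ℕ → Set Ordinal.{u}}
    (hX : ∀ i j, i < j → ∀ x ∈ X i, ∀ y ∈ X j, x < y)
    (h : ∀ β < α, ∀ N, ∃ n ≥ N, ω ^ β ≤ tp (X n)) : ω ^ α ≤ tp (⋃ n, X n) := by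
  by_contra! hlt
  obtain ⟨β, hβ, k, hk⟩ := (lt_omega0_opow hα).1 hlt
  exact absurd (mul_natCast_le_tp_iUnion hX (h β hβ) k 0) (by simpa using hk)

end OrderType

section Countable

open Ordinal

universe u

theorem omega1_eq : omega1.{u} = ω₁ := Cardinal.ord_aleph 1

theorem add_lt_omega1 {a b : Ordinal.{u}} (ha : a < omega1) (hb : b < omega1) :
    a + b < omega1 := by
  rw [omega1, Cardinal.lt_ord] at *
  rw [card_add]
  exact Cardinal.add_lt_of_lt (Cardinal.aleph0_le_aleph 1) ha hb

theorem countable_Iio_of_lt_omega1 {α : Ordinal.{u}} (h : α < omega1) : (Iio α).Countable := by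
  rw [← Cardinal.le_aleph0_iff_set_countable, Cardinal.mk_Iio_ordinal, Cardinal.lift_le_aleph0]
  rwa [omega1, Cardinal.lt_ord, ← Cardinal.succ_aleph0, Order.lt_succ_iff] at h

/-- A nonzero countable ordinal is approached from below by a sequence eventually above each
smaller ordinal; for a successor the sequence is eventually the predecessor. -/
theorem exists_seq_lt {α : Ordinal.{u}} (h : α < omega1) (hα : α ≠ 0) :
    ∃ a : ℕ → Ordinal.{u}, (∀ n, a n < α) ∧ ∀ β < α, ∃ N, ∀ n ≥ N, β ≤ a n := by
  have hne : (Iio α).Nonempty := ⟨0, pos_iff_ne_zero.2 hα⟩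
  obtain ⟨e, he⟩ := (countable_Iio_of_lt_omega1 h).exists_eq_range hne
  have hlt (i : ℕ) : e i < α := by
    change e i ∈ Iio α
    rw [he]
    exact mem_range_self i
  refine ⟨fun n => partialSups e n, fun n => ?_, fun β hβ => ?_⟩
  · simp only [partialSups_apply]
    exact (Finset.sup'_lt_iff _).2 fun i _ => hlt i
  · obtain ⟨N, rfl⟩ : β ∈ range e := he ▸ hβ
    exact ⟨N, fun n hn => le_partialSups_of_le e hn⟩

theorem exists_lt_omega1_forall_lt {G : ℕ → Ordinal.{u}} (hG : ∀ n, G n < omega1) :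
    ∃ s < omega1, ∀ n, G n < s := by
  rw [omega1_eq] at *
  refine ⟨⨆ n, Order.succ (G n), iSup_lt_omega_one fun n =>
    (Cardinal.isSuccLimit_omega 1).succ_lt (hG n), fun n => ?_⟩
  exact (Order.lt_succ (G n)).trans_le (Ordinal.le_iSup (fun n => Order.succ (G n)) n)

end Countable

section Sum

open Ordinal

universe u

/-- The sum `∑_U v_n`, transported to `ℕ` by the pairing function. -/
def natSum (U : Ultrafilter ℕ) (v : ℕ → Ultrafilter ℕ) : Ultrafilter ℕ :=
  U.bind fun n => (v n).map (Nat.pair n)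

theorem mem_natSum {U : Ultrafilter ℕ} {v : ℕ → Ultrafilter ℕ} {A : Set ℕ} :
    A ∈ natSum U v ↔ {n | {m | Nat.pair n m ∈ A} ∈ v n} ∈ U :=
  Iff.rfl

theorem IsPPoint.infinite_of_mem {U : Ultrafilter ℕ} (hU : IsPPoint U) {A : Set ℕ}
    (hA : A ∈ U) : A.Infinite := by
  intro hfin
  obtain ⟨a, -, ha⟩ := Ultrafilter.eq_pure_of_finite_mem hfin hA
  exact hU.1 a ha

/-- On a set in a P-point, every ordinal-valued function takes values below any given one only
finitely often. -/
theorem IsPPoint.exists_finite_lt {U : Ultrafilter ℕ} (hU : IsPPoint U) (d : ℕ → Ordinal.{u}) :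
    ∃ B ∈ U, ∀ a ∈ B, {n ∈ B | d n < d a}.Finite := by
  have hne : {e | {n | d n ≤ e} ∈ U}.Nonempty := by
    refine ⟨⨆ n, d n, ?_⟩
    exact Filter.mem_of_superset Filter.univ_mem fun n _ => Ordinal.le_iSup d n
  set e := sInf {e | {n | d n ≤ e} ∈ U}
  have hmem : {n | d n ≤ e} ∈ U := csInf_mem hne
  have hmin {c : Ordinal.{u}} (hc : c < e) : {n | c < d n} ∈ U := by
    have : {n | d n ≤ c} ∉ U := fun h => notMem_of_lt_csInf' hc h
    rw [← Ultrafilter.compl_mem_iff_notMem] at this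
    simpa [compl_ofPred] using this
  by_cases heq : {n | d n = e} ∈ U
  · refine ⟨_, heq, fun a ha => ?_⟩
    convert finite_empty
    ext n
    simp only [mem_ofPred_eq, mem_empty_iff_false, iff_false, not_and, not_lt] at ha ⊢
    intro hn
    exact (ha.trans hn.symm).le
  · have hlt : {n | d n < e} ∈ U := by
      filter_upwards [hmem, Ultrafilter.compl_mem_iff_notMem.2 heq] with n h1 h2
      exact lt_of_le_of_ne h1 h2
    obtain ⟨B, hB, hfin⟩ := hU.2 (fun k => {n | d k < e → d k < d n}) fun k => by
      by_cases hk : d k < e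
      · simpa [hk] using hmin hk
      · exact Filter.mem_of_superset Filter.univ_mem fun n _ h => absurd h hk
    refine ⟨B ∩ {n | d n < e}, Filter.inter_mem hB hlt, fun a ha => (hfin a).subset ?_⟩
    rintro n ⟨hn, hna⟩
    exact ⟨hn.1, fun h => lt_asymm hna (h ha.2)⟩

theorem alphaUltra_natSum {U : Ultrafilter ℕ} (hU : IsPPoint U) {v : ℕ → Ultrafilter ℕ}
    {α : Ordinal.{u + 1}} {c : ℕ → Ordinal.{u + 1}} (hc : ∀ n, c n < ω ^ α)
    (hv : ∀ n, AlphaUltra (c n) (v n)) : AlphaUltra (ω ^ α) (natSum U v) := by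
  intro F hF
  choose B hB hBc using fun n => hv n (fun m => F (Nat.pair n m)) fun m => hF _
  set d : ℕ → Ordinal.{u} := fun n => sInf {e | {m | F (Nat.pair n m) < e} ∈ v n}
  have hdmem (n : ℕ) : {m | F (Nat.pair n m) < d n} ∈ v n := by
    refine csInf_mem (s := {e | {m | F (Nat.pair n m) < e} ∈ v n}) ⟨omega1, ?_⟩
    exact Filter.mem_of_superset Filter.univ_mem fun m _ => hF _
  have hdmin {n : ℕ} {x : Ordinal.{u}} (hx : x < d n) : {m | x ≤ F (Nat.pair n m)} ∈ v n := by
    have : {m | F (Nat.pair n m) < x} ∉ v n := fun h => notMem_of_lt_csInf' hx h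
    rw [← Ultrafilter.compl_mem_iff_notMem] at this
    simpa [compl_ofPred] using this
  obtain ⟨C, hC, hfin⟩ := hU.exists_finite_lt d
  refine ⟨{p | p.unpair.1 ∈ C ∧ p.unpair.2 ∈ B p.unpair.1 ∧ F p < d p.unpair.1 ∧
    ∀ k ∈ Iic p.unpair.1, F k < d p.unpair.1 → F k ≤ F p}, ?_, ?_⟩
  · rw [mem_natSum]
    filter_upwards [hC] with n hn
    have hcut : {m | ∀ k ∈ Iic n, F k < d n → F k ≤ F (Nat.pair n m)} ∈ v n := by
      refine (Filter.eventually_all_finite (finite_Iic n)).2 fun k _ => ?_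
      by_cases hk : F k < d n
      · filter_upwards [hdmin hk] with m hm _ using hm
      · simp [hk]
    filter_upwards [hB n, hdmem n, hcut] with m h1 h2 h3
    simpa [hn, h1] using ⟨h2, h3⟩
  · refine tp_le_of_forall ?_
    rintro _ ⟨p, ⟨hpC, -, hpd, -⟩, rfl⟩
    refine (tp_mono ?_).trans_lt (tp_biUnion_lt_opow
      ((hfin _ hpC).union (finite_Iio p)) fun n _ => (hBc n).trans_lt (hc n))
    rintro _ ⟨⟨q, ⟨hqC, hqB, -, hq⟩, rfl⟩, hqp⟩
    refine mem_iUnion₂.2 ⟨q.unpair.1, ?_, q.unpair.2, hqB, by simp⟩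
    by_contra hn
    simp only [mem_union, mem_ofPred_eq, mem_Iio, not_or, not_and, not_lt] at hn
    exact absurd (hq p hn.2 (hpd.trans_le (hn.1 hqC))) (not_le.2 hqp)

theorem exists_opow_le_tp_natSum {U : Ultrafilter ℕ} (hU : IsPPoint U) {v : ℕ → Ultrafilter ℕ}
    {α : Ordinal.{u + 1}} (hα : α ≠ 0) {a : ℕ → Ordinal.{u + 1}}
    (ha : ∀ β < α, ∃ N, ∀ n ≥ N, β ≤ a n) {G : ℕ → ℕ → Ordinal.{u}}
    (hG : ∀ n m, G n m < omega1) (hGv : ∀ n, ∀ A ∈ v n, ω ^ a n ≤ tp (G n '' A)) :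
    ∃ F : ℕ → Ordinal.{u}, (∀ p, F p < omega1) ∧
      ∀ A ∈ natSum U v, ω ^ α ≤ tp (F '' A) := by
  choose s hs hGs using fun n => exists_lt_omega1_forall_lt (hG n)
  set b : ℕ → Ordinal.{u} := fun n => Nat.rec 0 (fun k x => x + s k) n
  have hb_succ (n : ℕ) : b (n + 1) = b n + s n := rfl
  have hb_mono : Monotone b := monotone_nat_of_le_succ fun n => by simp [hb_succ]
  have hb_lt (n : ℕ) : b n < omega1 := by
    induction n with
    | zero => exact pos_of_gt (hG 0 0)
    | succ n ih => exact hb_succ n ▸ add_lt_omega1 ih (hs n)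
  refine ⟨fun p => b p.unpair.1 + G p.unpair.1 p.unpair.2,
    fun p => add_lt_omega1 (hb_lt _) (hG _ _), fun A hA => ?_⟩
  set X : ℕ → Set Ordinal.{u} := fun n => (b n + ·) '' (G n '' {m | Nat.pair n m ∈ A})
  refine (opow_le_tp_iUnion hα (X := X) ?_ fun β hβ N => ?_).trans (tp_mono ?_)
  · rintro i j hij _ ⟨_, ⟨m, -, rfl⟩, rfl⟩ _ ⟨y, -, rfl⟩
    calc b i + G i m < b i + s i := by simpa using hGs i m
      _ ≤ b j := hb_mono hij
      _ ≤ b j + y := le_self_add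
  · obtain ⟨M, hM⟩ := ha β hβ
    obtain ⟨n, hn, hNn⟩ := (hU.infinite_of_mem (mem_natSum.1 hA)).exists_gt (max M N)
    refine ⟨n, (le_max_right M N).trans hNn.le, ?_⟩
    refine (opow_le_opow_right omega0_pos (hM n ((le_max_left M N).trans hNn.le))).trans
      ((hGv n _ hn).trans ?_)
    exact tp_le_of_strictMonoOn (f := (b n + ·)) (fun x _ y _ hxy => by simpa using hxy)
      (mapsTo_image _ _)
  · refine iUnion_subset fun n => ?_
    rintro _ ⟨_, ⟨m, hm, rfl⟩, rfl⟩
    exact ⟨Nat.pair n m, hm, by simp⟩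

theorem exists_alphaUltra_opow {U : Ultrafilter ℕ} (hU : IsPPoint U) (α : Ordinal.{u + 1})
    (hα : α < omega1) : ∃ w : Ultrafilter ℕ, AlphaUltra (ω ^ α) w ∧
      ∃ F : ℕ → Ordinal.{u}, (∀ n, F n < omega1) ∧ ∀ A ∈ w, ω ^ α ≤ tp (F '' A) := by
  induction α using WellFoundedLT.induction with
  | ind α ih =>
    rcases eq_or_ne α 0 with rfl | hα0
    · refine ⟨pure 0, fun F _ => ⟨{0}, by simp, ?_⟩, fun _ => 0, fun _ => ?_, fun A hA => ?_⟩
      · rw [image_singleton, opow_zero]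
        refine tp_le_of_forall ?_
        simp
      · simp [omega1_eq, omega_pos]
      · rw [opow_zero, one_le_tp]
        exact ((pure 0 : Ultrafilter ℕ).nonempty_of_mem hA).image _
    · obtain ⟨a, ha, hcof⟩ := exists_seq_lt hα hα0
      choose v hv G hG hGv using fun n => ih (a n) (ha n) ((ha n).trans hα)
      exact ⟨natSum U v, alphaUltra_natSum hU
          (fun n => (opow_lt_opow_iff_right one_lt_omega0).2 (ha n)) hv,
        exists_opow_le_tp_natSum hU hα0 hcof hG hGv⟩

end Sum

/-- if there is a P-point then for all `α < ω₁` there is a proper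
`ω^α`-ultrafilter. -/
theorem stmt16 (h : ∃ u : Ultrafilter ℕ, IsPPoint u) :
    ∀ α < omega1, ∃ u : Ultrafilter ℕ,
      AlphaUltra (Ordinal.omega0 ^ α) u ∧
      ∀ β < Ordinal.omega0 ^ α, ¬ AlphaUltra β u := by
  intro α hα
  obtain ⟨U, hU⟩ := h
  obtain ⟨w, hw, F, hF, hFw⟩ := exists_alphaUltra_opow hU α hα
  refine ⟨w, hw, fun β hβ hβw => ?_⟩
  obtain ⟨A, hA, hAβ⟩ := hβw F hF
  exact absurd ((hFw A hA).trans hAβ) (not_le.2 hβ)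
end

section
/- Let α < ω₁ and let u be a proper ω^{α+1}-ultrafilter on ℕ (ordinal exponentiation). Then there exists a P-point ultrafilter v on ℕ with v ≤_RK u. -/
open Set Topology Filter MeasureTheory

universe w v

/-- `F` restricted to `A` admits a strictly order-preserving reparametrization below `β`. -/
def EmbedsBelow (F : ℕ → Ordinal.{w}) (A : Set ℕ) (β : Ordinal.{v}) : Prop :=
  ∃ φ : ℕ → Ordinal.{v}, (∀ m ∈ A, φ m < β) ∧ ∀ m ∈ A, ∀ n ∈ A, F m < F n → φ m < φ n

lemma tp_image_le_iff (F : ℕ → Ordinal.{w}) (A : Set ℕ) (β : Ordinal.{w + 1}) :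
    tp (F '' A) ≤ β ↔ EmbedsBelow F A β := by
  constructor
  · intro h
    classical
    refine ⟨fun n => if hn : n ∈ A then
      Ordinal.typein ((· < ·) : (F '' A) → (F '' A) → Prop) ⟨F n, n, hn, rfl⟩ else 0, ?_, ?_⟩
    · intro m hm
      simp only [hm, dite_true]
      exact (Ordinal.typein_lt_type _ _).trans_le h
    · intro m hm n hn hmn
      simp only [hm, hn, dite_true]
      exact (Ordinal.typein_lt_typein _).2 hmn
  · rintro ⟨φ, hφ, hmono⟩
    choose g hg hFg using fun x : (F '' A) => x.2
    have key : StrictMono fun x : (F '' A) =>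
        (Ordinal.ToType.mk (o := β) ⟨φ (g x), hφ _ (hg x)⟩) := by
      intro x y hxy
      rw [OrderIso.lt_iff_lt]
      refine hmono _ (hg x) _ (hg y) ?_
      rw [hFg, hFg]
      exact hxy
    have := Ordinal.type_le_iff'.2 ⟨(OrderEmbedding.ofStrictMono _ key).ltEmbedding⟩
    rwa [Ordinal.type_toType] at this

lemma lift_omega1 : Ordinal.lift.{w + 1} omega1.{w} = omega1.{w + 1} := by
  simp [omega1]

lemma exists_embedsBelow_of_alphaUltra {β : Ordinal.{w + 1}} {u : Ultrafilter ℕ}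
    (h : AlphaUltra β u) (G : ℕ → Ordinal.{w + 1}) (hG : ∀ n, G n < omega1) :
    ∃ A ∈ u, EmbedsBelow G A β := by
  have hl : ∀ n, ∃ a : Ordinal.{w}, Ordinal.lift.{w + 1} a = G n := fun n =>
    Ordinal.mem_range_lift_of_le ((hG n).le.trans lift_omega1.symm.le)
  choose G' hG' using hl
  obtain ⟨A, hA, hAle⟩ := h G' fun n => by
    rw [← Ordinal.lift_lt.{w + 1}, hG', lift_omega1]
    exact hG n
  obtain ⟨φ, hφ, hmono⟩ := (tp_image_le_iff _ _ _).1 hAle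
  refine ⟨A, hA, φ, hφ, fun m hm n hn hmn => hmono m hm n hn ?_⟩
  rwa [← hG', ← hG', Ordinal.lift_lt] at hmn

lemma isPPoint_of_fibers {v : Ultrafilter ℕ} (hv : ∀ a : ℕ, {a} ∉ v)
    (h : ∀ g : ℕ → ℕ, ∃ B ∈ v, ∀ i j, i < j → (∃ k ∈ B, g k = j) → {k ∈ B | g k = i}.Finite) :
    IsPPoint v := by
  classical
  refine ⟨fun a ha => hv a (by rw [ha]; exact mem_pure.2 rfl), fun A hA => ?_⟩
  by_cases hW : (⋂ n, A n) ∈ v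
  · refine ⟨_, hW, fun n => ?_⟩
    rw [sdiff_eq_empty.2 (iInter_subset _ n)]
    exact finite_empty
  have hex : ∀ k, k ∉ (⋂ n, A n) → ∃ n, k ∉ A n := fun k hk => by simpa using hk
  obtain ⟨B, hB, hBg⟩ := h fun k => sInf {n | k ∉ A n}
  refine ⟨B ∩ (⋂ n, A n)ᶜ, inter_mem hB (Ultrafilter.compl_mem_iff_notMem.2 hW), fun n => ?_⟩
  have hfin : ∀ i, {k ∈ B | sInf {n | k ∉ A n} = i}.Finite := by
    intro i
    have hmem : (B ∩ (⋂ n, A n)ᶜ) ∩ (⋂ j ∈ Finset.range (i + 1), A j) ∈ v :=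
      inter_mem (inter_mem hB (Ultrafilter.compl_mem_iff_notMem.2 hW))
        ((biInter_finset_mem _).2 fun j _ => hA j)
    obtain ⟨k, ⟨hkB, hkW⟩, hk⟩ := Ultrafilter.nonempty_of_mem hmem
    refine hBg i _ ?_ ⟨k, hkB, rfl⟩
    by_contra! hle
    have h1 : k ∉ A (sInf {n | k ∉ A n}) := Nat.sInf_mem (hex k hkW)
    exact h1 (mem_iInter₂.1 hk _ (Finset.mem_range.2 (by omega)))
  refine ((finite_le_nat n).biUnion fun i _ => hfin i).subset ?_
  rintro k ⟨⟨hkB, -⟩, hk⟩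
  exact mem_iUnion₂.2 ⟨_, Nat.sInf_le hk, hkB, rfl⟩

lemma lt_of_mul_add_lt {p a b c d : Ordinal.{w}} (hd : d < p)
    (h : p * a + c < p * b + d) : a ≤ b := by
  by_contra! hlt
  refine absurd h (not_lt.2 ?_)
  calc p * b + d ≤ p * b + p := by gcongr
    _ = p * (b + 1) := by rw [mul_add, mul_one]
    _ ≤ p * a := mul_le_mul_right (Order.add_one_le_of_lt hlt) p
    _ ≤ p * a + c := le_self_add

lemma mul_add_lt_of_lt {p a b c d : Ordinal.{w}} (hc : c < p) (hab : a < b) :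
    p * a + c < p * b + d :=
  calc p * a + c < p * a + p := by gcongr
    _ = p * (a + 1) := by rw [mul_add, mul_one]
    _ ≤ p * b := mul_le_mul_right (Order.add_one_le_of_lt hab) p
    _ ≤ p * b + d := le_self_add

/-- If `F` has no reparametrization below `p = ω ^ α` on any member of `u`, then the blocks of `F`
which have no reparametrization below an ordinal less than `p` are many. -/
lemma large_blocks_mem {u : Ultrafilter ℕ} {α : Ordinal.{w}} {F : ℕ → Ordinal.{w}}
    (hn : ∀ A ∈ u, ¬ EmbedsBelow F A (Ordinal.omega0 ^ α)) {f : ℕ → ℕ} {r : ℕ → Ordinal.{w}}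
    (hr : ∀ n, r n < Ordinal.omega0 ^ α) (hF : ∀ n, F n = Ordinal.omega0 ^ α * f n + r n)
    {A : Set ℕ} (hA : A ∈ u) :
    {k | ∀ β < Ordinal.omega0 ^ α, ¬ EmbedsBelow F {n ∈ A | f n = k} β} ∈ u.map f := by
  classical
  by_contra hB
  rw [← Ultrafilter.compl_mem_iff_notMem, Ultrafilter.mem_map] at hB
  have hex : ∀ k, ∃ β < Ordinal.omega0 ^ α, ∃ φ : ℕ → Ordinal.{w},
      k ∈ {k | ∀ β < Ordinal.omega0 ^ α, ¬ EmbedsBelow F {n ∈ A | f n = k} β}ᶜ →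
      (∀ m ∈ {n ∈ A | f n = k}, φ m < β) ∧
      ∀ m ∈ {n ∈ A | f n = k}, ∀ n ∈ {n ∈ A | f n = k}, F m < F n → φ m < φ n := by
    intro k
    by_cases hk : k ∈ {k | ∀ β < Ordinal.omega0 ^ α, ¬ EmbedsBelow F {n ∈ A | f n = k} β}ᶜ
    · have hk' := hk
      simp only [mem_compl_iff, mem_ofPred_eq, not_forall, not_not] at hk'
      obtain ⟨β, hβ, φ, hφ⟩ := hk'
      exact ⟨β, hβ, φ, fun _ => hφ⟩
    · exact ⟨0, Ordinal.opow_pos _ Ordinal.omega0_pos, 0, fun h => absurd h hk⟩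
  choose β hβ φ hφ using hex
  let S : ℕ → Ordinal.{w} := fun k => Nat.rec 0 (fun k s => s + β k) k
  have hS : ∀ k, S (k + 1) = S k + β k := fun k => rfl
  have hSlt : ∀ k, S k < Ordinal.omega0 ^ α := by
    intro k
    induction k with
    | zero => exact Ordinal.opow_pos _ Ordinal.omega0_pos
    | succ k ih => exact Ordinal.isPrincipal_add_omega0_opow α ih (hβ k)
  have hSmono : Monotone S := monotone_nat_of_le_succ fun k => by rw [hS]; exact le_self_add
  refine hn _ (inter_mem hA hB) ⟨fun n => S (f n) + φ (f n) n, ?_, ?_⟩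
  · rintro m ⟨hmA, hm⟩
    refine Ordinal.isPrincipal_add_omega0_opow α (hSlt _) (((hφ _ hm).1 m ⟨hmA, rfl⟩).trans (hβ _))
  · rintro m ⟨hmA, hm⟩ n ⟨hnA, hn⟩ hmn
    have hle : f m ≤ f n := by
      have := hmn
      rw [hF m, hF n] at this
      exact_mod_cast lt_of_mul_add_lt (hr n) this
    rcases hle.lt_or_eq with hlt | heq
    · calc S (f m) + φ (f m) m < S (f m) + β (f m) := by
            gcongr
            exact (hφ _ hm).1 m ⟨hmA, rfl⟩
        _ = S (f m + 1) := (hS _).symm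
        _ ≤ S (f n) := hSmono hlt
        _ ≤ _ := le_self_add
    · have := (hφ _ hn).2 m ⟨hmA, heq⟩ n ⟨hnA, rfl⟩ hmn
      simp only [heq]
      gcongr

lemma isPPoint_map_block {u : Ultrafilter ℕ} {α : Ordinal.{w}} (hα : α < omega1)
    {F : ℕ → Ordinal.{w}} (hn : ∀ A ∈ u, ¬ EmbedsBelow F A (Ordinal.omega0 ^ α))
    {f : ℕ → ℕ} {r : ℕ → Ordinal.{w}}
    (hr : ∀ n, r n < Ordinal.omega0 ^ α) (hF : ∀ n, F n = Ordinal.omega0 ^ α * f n + r n)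
    (hu : ∀ G : ℕ → Ordinal.{w}, (∀ n, G n < omega1) →
      ∃ A ∈ u, EmbedsBelow G A (Ordinal.omega0 ^ (α + 1))) :
    IsPPoint (u.map f) := by
  have hpos : 0 < Ordinal.omega0 ^ α := Ordinal.opow_pos _ Ordinal.omega0_pos
  have hω : Ordinal.omega0 < omega1.{w} := by
    rw [omega1, Cardinal.ord_aleph]
    exact Ordinal.omega0_lt_omega_one
  have hpω : Ordinal.omega0 ^ α < omega1 := by
    have := Ordinal.isPrincipal_opow_ord (Cardinal.aleph0_le_aleph.{w} 1)
    exact this hω hα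
  have hmul : Ordinal.IsPrincipal (· * ·) omega1.{w} :=
    Ordinal.isPrincipal_mul_ord (Cardinal.aleph0_le_aleph.{w} 1)
  have hadd : Ordinal.IsPrincipal (· + ·) omega1.{w} :=
    Ordinal.isPrincipal_add_ord (Cardinal.aleph0_le_aleph.{w} 1)
  have hnat : ∀ n : ℕ, (n : Ordinal.{w}) < omega1 := fun n => (Ordinal.natCast_lt_omega0 n).trans hω
  apply isPPoint_of_fibers
  · intro a ha
    rw [Ultrafilter.mem_map] at ha
    refine hn _ ha ⟨r, fun m _ => hr m, fun m hm n hn' hmn => ?_⟩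
    have hm : f m = a := hm
    have hn' : f n = a := hn'
    rw [hF m, hF n, hm, hn'] at hmn
    exact (add_lt_add_iff_left _).1 hmn
  intro g
  let c : ℕ → Ordinal.{w} := fun k => Ordinal.omega0 * (g k : Ordinal.{w}) + k
  have hc_lt : ∀ k l, g k < g l → c k < c l := fun k l h =>
    mul_add_lt_of_lt (Ordinal.natCast_lt_omega0 k) (by exact_mod_cast h)
  have hc_lt' : ∀ k l, g k = g l → k < l → c k < c l := fun k l h hkl => by
    simp only [c, h]
    gcongr
  let G : ℕ → Ordinal.{w} := fun n => Ordinal.omega0 ^ α * c (f n) + r n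
  have hG_lt : ∀ m n, c (f m) < c (f n) → G m < G n := fun m n h => mul_add_lt_of_lt (hr m) h
  obtain ⟨A, hA, ψ, hψ, hmono⟩ := hu G fun n =>
    hadd (hmul hpω (hadd (hmul hω (hnat _)) (hnat _))) ((hr n).trans hpω)
  refine ⟨_, large_blocks_mem hn hr hF hA, fun i j hij hj => ?_⟩
  obtain ⟨k₀, hk₀, rfl⟩ := hj
  by_contra hinf
  have hne : ∀ k, (∀ β < Ordinal.omega0 ^ α, ¬ EmbedsBelow F {n ∈ A | f n = k} β) →
      ∃ n ∈ A, f n = k := by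
    intro k hk
    by_contra! hemp
    refine hk 0 hpos ⟨0, fun m hm => absurd hm.2 (hemp m hm.1),
      fun m hm => absurd hm.2 (hemp m hm.1)⟩
  have climb : ∀ N : ℕ, ∃ k, (∀ β < Ordinal.omega0 ^ α, ¬ EmbedsBelow F {n ∈ A | f n = k} β) ∧
      g k = i ∧ ∀ m ∈ A, f m = k → Ordinal.omega0 ^ α * N ≤ ψ m := by
    intro N
    induction N with
    | zero =>
      obtain ⟨k, hk, hki⟩ := (Set.not_finite.1 hinf : Set.Infinite _).nonempty
      exact ⟨k, hk, hki, fun m _ _ => by simp⟩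
    | succ N ih =>
      obtain ⟨k, hk, hki, hge⟩ := ih
      obtain ⟨l, ⟨hl, hli⟩, hkl⟩ := (Set.not_finite.1 hinf : Set.Infinite _).exists_gt k
      refine ⟨l, hl, hli, fun m hm hml => ?_⟩
      by_contra! hlt
      have hbelow : ∀ n ∈ A, f n = k → ψ n < ψ m := fun n hn hnk =>
        hmono n hn m hm (hG_lt _ _ (by
          rw [hnk, hml]
          exact hc_lt' _ _ (hki.trans hli.symm) hkl))
      obtain ⟨n₀, hn₀, hn₀k⟩ := hne k hk
      have hm_ge : Ordinal.omega0 ^ α * N ≤ ψ m :=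
        (hge n₀ hn₀ hn₀k).trans (hbelow n₀ hn₀ hn₀k).le
      have hsub : ∀ x, Ordinal.omega0 ^ α * N ≤ x →
          Ordinal.omega0 ^ α * N + (x - Ordinal.omega0 ^ α * N) = x :=
        fun x hx => Ordinal.add_sub_cancel_of_le hx
      refine hk (ψ m - Ordinal.omega0 ^ α * N) ?_ ⟨fun n => ψ n - Ordinal.omega0 ^ α * N, ?_, ?_⟩
      · rw [← add_lt_add_iff_left (Ordinal.omega0 ^ α * N), hsub _ hm_ge]
        simpa [mul_add] using hlt
      · rintro n ⟨hn, hnk⟩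
        rw [← add_lt_add_iff_left (Ordinal.omega0 ^ α * N), hsub _ hm_ge, hsub _ (hge n hn hnk)]
        exact hbelow n hn hnk
      · rintro n ⟨hn, hnk⟩ n' ⟨hn', hnk'⟩ hnn
        rw [← add_lt_add_iff_left (Ordinal.omega0 ^ α * N), hsub _ (hge n hn hnk),
          hsub _ (hge n' hn' hnk')]
        refine hmono n hn n' hn' ?_
        rw [hF n, hF n', hnk, hnk'] at hnn
        simp only [G, hnk, hnk']
        exact (add_lt_add_iff_left _).2 ((add_lt_add_iff_left _).1 hnn)
  obtain ⟨n₀, hn₀, hn₀k⟩ := hne k₀ hk₀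
  have hb := hψ n₀ hn₀
  rw [Ordinal.opow_add, Ordinal.opow_one,
    Ordinal.lt_mul_iff_of_isSuccLimit Ordinal.isSuccLimit_omega0] at hb
  obtain ⟨c', hc', hb⟩ := hb
  obtain ⟨N, rfl⟩ := Ordinal.lt_omega0.1 hc'
  obtain ⟨k, hk, hki, hge⟩ := climb N
  obtain ⟨m, hm, hmk⟩ := hne k hk
  have hlt : ψ m < ψ n₀ := hmono m hm n₀ hn₀ (hG_lt _ _ (by
    rw [hmk, hn₀k]
    exact hc_lt _ _ (hki.trans_lt hij)))
  exact absurd ((hge m hm hmk).trans_lt (hlt.trans hb)) (lt_irrefl _)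

/-- below every proper `ω^(α+1)`-ultrafilter there is a P-point in the
Rudin–Keisler ordering. -/
theorem stmt17 (α : Ordinal) (hα : α < omega1) (u : Ultrafilter ℕ)
    (hu : AlphaUltra (Ordinal.omega0 ^ (α + 1)) u)
    (hproper : ∀ β < Ordinal.omega0 ^ (α + 1), ¬ AlphaUltra β u) :
    ∃ v : Ultrafilter ℕ, IsPPoint v ∧ ∃ f : ℕ → ℕ, v = Ultrafilter.map f u := by
  classical
  have hpos : 0 < Ordinal.omega0 ^ α := Ordinal.opow_pos _ Ordinal.omega0_pos
  have hnot := hproper (Ordinal.omega0 ^ α)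
    ((Ordinal.opow_lt_opow_iff_right Ordinal.one_lt_omega0).2 (lt_add_one α))
  simp only [AlphaUltra, not_forall, not_exists, not_and, tp_image_le_iff] at hnot
  obtain ⟨F, hF, hnot⟩ := hnot
  obtain ⟨A₀, hA₀, hle⟩ := hu F hF
  obtain ⟨φ, hφ, hφmono⟩ := (tp_image_le_iff _ _ _).1 hle
  let F' := fun n => if n ∈ A₀ then φ n else 0
  have hF' : ∀ n, F' n < Ordinal.omega0 ^ α * Ordinal.omega0 := fun n => by
    by_cases h : n ∈ A₀
    · simpa [F', h, Ordinal.opow_add] using hφ n h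
    · simpa [F', h] using mul_pos hpos Ordinal.omega0_pos
  have hnot' : ∀ A ∈ u, ¬ EmbedsBelow F' A (Ordinal.omega0 ^ α) := by
    rintro A hA ⟨χ, hχ, hχmono⟩
    refine hnot _ (inter_mem hA hA₀) ⟨χ, fun m hm => hχ m hm.1, fun m hm n hn hmn => ?_⟩
    refine hχmono m hm.1 n hn.1 ?_
    simpa [F', hm.2, hn.2] using hφmono m hm.2 n hn.2 hmn
  have hdiv : ∀ n, ∃ k : ℕ, F' n / Ordinal.omega0 ^ α = k := fun n =>
    Ordinal.lt_omega0.1 ((Ordinal.lt_mul_iff_div_lt hpos.ne').1 (hF' n))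
  choose f hf using hdiv
  refine ⟨u.map f, isPPoint_map_block hα hnot' (r := fun n => F' n % Ordinal.omega0 ^ α)
    (fun n => Ordinal.mod_lt _ hpos.ne') (fun n => ?_)
    (exists_embedsBelow_of_alphaUltra hu), f, rfl⟩
  rw [← hf, Ordinal.div_add_mod]
end
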